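/- Let (X, μ, T) be an ergodic measure preserving system on a compact metric space, let ℓ, m be positive integers, let a ∈ X be T-generic for μ along some Følner sequence Φ in ℕ, and let E ⊆ X be an open set with μ(E) > 0. Then there exist x₁, x₂ ∈ X and a positive integer t such that (a, x₁, x₂) is an (ℓ,m)-Erdős progression and T^t x₂ ∈ E. -/

import Mathlib

open Filter MeasureTheory Topology

/-- A Følner sequence in `ℕ`. -/
def IsFolnerSeq (Φ : ℕ → Finset ℕ) : Prop :=
  (∀ N, (Φ N).Nonempty) ∧
  ∀ t : ℕ, Filter.Tendsto
    (fun N => ((Φ N ∩ (Φ N).image (fun n => t + n)).card : ℝ) / ((Φ N).card : ℝ))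
    Filter.atTop (nhds 1)

/-- `a` is `T`-generic for `μ` along the Følner sequence `Φ`: the empirical measures
along orbits converge to `μ` in the weak* topology. -/
def GenericAlong {X : Type*} [TopologicalSpace X] [MeasurableSpace X]
    (T : X → X) (μ : MeasureTheory.Measure X) (a : X) (Φ : ℕ → Finset ℕ) : Prop :=
  ∀ f : C(X, ℝ), Filter.Tendsto
    (fun N => (∑ n ∈ Φ N, f (T^[n] a)) / ((Φ N).card : ℝ))
    Filter.atTop (nhds (∫ x, f x ∂μ))

/-- `(x₀, x₁, x₂)` is an `(ℓ,m)`-Erdős progression for `T`. -/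
def ErdosProg {X : Type*} [TopologicalSpace X] (T : X → X) (ℓ m : ℕ)
    (x₀ x₁ x₂ : X) : Prop :=
  ∃ n : ℕ → ℕ, StrictMono n ∧ (∀ i, 0 < n i) ∧
    Filter.Tendsto (fun i => (T^[ℓ * n i] x₀, T^[m * n i] x₁)) Filter.atTop
      (nhds (x₁, x₂))

section HilbertPart
variable {H : Type*} [NormedAddCommGroup H] [InnerProductSpace ℂ H] [CompleteSpace H]

theorem compact_of_trace_bound (A : H →L[ℂ] H)
    (hcs : ∀ x y, ‖inner ℂ (A x) y‖ ^ 2 ≤ (inner ℂ (A x) x).re * (inner ℂ (A y) y).re)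
    (hpos : ∀ x, 0 ≤ (inner ℂ (A x) x).re)
    (C : ℝ) (htr : ∀ s : Finset H, Orthonormal ℂ (fun x : s => (x : H)) →
      ∑ x ∈ s, (inner ℂ (A x) x).re ≤ C) : IsCompactOperator A := by
  classical
  -- small norm off a finite-dimensional space
  have key : ∀ ε > 0, ∃ s : Finset H, ∀ x : H, ‖x‖ = 1 → (∀ y ∈ s, inner ℂ y x = 0) →
      (inner ℂ (A x) x).re ≤ ε := by
    intro ε hε
    let S : Set ℝ := {t | ∃ s : Finset H, Orthonormal ℂ (fun x : s => (x : H)) ∧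
      t = ∑ x ∈ s, (inner ℂ (A x) x).re}
    have hne : S.Nonempty := by
      refine ⟨0, ∅, ?_, by simp⟩
      constructor
      · intro i; exact absurd i.2 (Finset.notMem_empty _)
      · intro i; exact absurd i.2 (Finset.notMem_empty _)
    have hbd : BddAbove S := ⟨C, by rintro t ⟨s, hs, rfl⟩; exact htr s hs⟩
    obtain ⟨t, ⟨s, hs, rfl⟩, hlt⟩ := exists_lt_of_lt_csSup hne (show sSup S - ε < sSup S by linarith)
    refine ⟨s, fun x hx hxs => ?_⟩
    have hxn : x ∉ s := by
      intro h
      have := hxs x h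
      rw [inner_self_eq_zero] at this
      simp [this] at hx
    have hort : Orthonormal ℂ (fun y : (insert x s : Finset H) => (y : H)) := by
      have h1 := (orthonormal_subtype_iff_ite (𝕜 := ℂ) (s := (s : Set H))).1 hs
      refine (orthonormal_subtype_iff_ite (𝕜 := ℂ) (s := ((insert x s : Finset H) : Set H))).2 ?_
      intro v hv w hw
      simp only [Finset.coe_insert, Set.mem_insert_iff, Finset.mem_coe] at hv hw
      have hxx : inner ℂ x x = 1 := by rw [inner_self_eq_norm_sq_to_K, hx]; simp
      rcases hv with rfl | hv <;> rcases hw with rfl | hw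
      · rw [if_pos rfl, hxx]
      · rw [if_neg (by rintro rfl; exact hxn hw), ← inner_conj_symm, hxs w hw]; simp
      · rw [if_neg (by rintro rfl; exact hxn hv), hxs v hv]
      · exact h1 v hv w hw
    have : ∑ y ∈ insert x s, (inner ℂ (A y) y).re ≤ sSup S := le_csSup hbd ⟨_, hort, rfl⟩
    rw [Finset.sum_insert hxn] at this
    linarith
  -- operator norm bound
  have key2 : ∀ δ > 0, ∃ P : H →L[ℂ] H, IsCompactOperator P ∧ ‖A - P‖ ≤ δ := by
    intro δ hδ
    obtain ⟨s, hs⟩ := key (δ ^ 2 / (‖A‖ + 1)) (by positivity)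
    let V : Submodule ℂ H := Submodule.span ℂ (s : Set H)
    have : FiniteDimensional ℂ V := FiniteDimensional.span_finset ℂ s
    have bound : ∀ x : H, (∀ y ∈ s, inner ℂ y x = 0) → ‖A x‖ ≤ δ * ‖x‖ := by
      intro x hx
      by_cases hx0 : x = 0
      · simp [hx0]
      have hn : 0 < ‖x‖ := norm_pos_iff.2 hx0
      have h1 := hs ((‖x‖⁻¹ : ℂ) • x) (by simp [norm_smul, hn.ne']) (by
        intro y hy; simp [inner_smul_right, hx y hy])
      have h2 : (inner ℂ (A ((‖x‖⁻¹ : ℂ) • x)) ((‖x‖⁻¹ : ℂ) • x)).re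
          = (‖x‖⁻¹)^2 * (inner ℂ (A x) x).re := by
        rw [map_smul, inner_smul_left, inner_smul_right, ← Complex.ofReal_inv, Complex.conj_ofReal,
          Complex.re_ofReal_mul, Complex.re_ofReal_mul]
        ring
      rw [h2] at h1
      have h3 : (inner ℂ (A x) x).re ≤ δ ^ 2 / (‖A‖ + 1) * ‖x‖^2 := by
        have : (inner ℂ (A x) x).re = ((‖x‖⁻¹)^2 * (inner ℂ (A x) x).re) * ‖x‖^2 := by
          field_simp
        rw [this]
        gcongr
      have h4 := hcs x (A x)
      have h5 : (inner ℂ (A (A x)) (A x)).re ≤ ‖A‖ * ‖A x‖^2 := by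
        calc (inner ℂ (A (A x)) (A x)).re ≤ ‖inner ℂ (A (A x)) (A x)‖ := Complex.re_le_norm _
          _ ≤ ‖A (A x)‖ * ‖A x‖ := norm_inner_le_norm _ _
          _ ≤ (‖A‖ * ‖A x‖) * ‖A x‖ := by gcongr; exact A.le_opNorm _
          _ = _ := by ring
      have h6 : ‖inner ℂ (A x) (A x)‖ = ‖A x‖^2 := by
        rw [inner_self_eq_norm_sq_to_K]; simp
      rw [h6] at h4
      have h7 : (‖A x‖^2)^2 ≤ (δ^2 * ‖x‖^2) * ‖A x‖^2 := by
        calc (‖A x‖^2)^2 ≤ (inner ℂ (A x) x).re * (inner ℂ (A (A x)) (A x)).re := h4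
          _ ≤ (δ ^ 2 / (‖A‖ + 1) * ‖x‖^2) * (‖A‖ * ‖A x‖^2) := by
              gcongr
              exact hpos _
          _ ≤ (δ ^ 2 / (‖A‖ + 1) * ‖x‖^2) * ((‖A‖ + 1) * ‖A x‖^2) := by
              gcongr; linarith
          _ = _ := by field_simp
      by_cases hA : A x = 0
      · rw [hA, norm_zero]; positivity
      have hAp : 0 < ‖A x‖^2 := by have := norm_pos_iff.2 hA; positivity
      have h8 : ‖A x‖^2 ≤ (δ * ‖x‖)^2 := by
        rw [mul_pow]; exact le_of_mul_le_mul_right (by nlinarith) hAp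
      exact le_of_sq_le_sq h8 (by positivity)
    refine ⟨A ∘L V.starProjection, ?_, ?_⟩
    · have : IsCompactOperator (V.orthogonalProjectionOnto) :=
        isCompactOperator_of_locallyCompactSpace_dom _
      exact this.clm_comp (A ∘L V.subtypeL)
    · refine ContinuousLinearMap.opNorm_le_bound _ hδ.le fun x => ?_
      have : (A - A ∘L V.starProjection) x = A (x - V.starProjection x) := by simp
      rw [this]
      have hperp : x - V.starProjection x ∈ Vᗮ := Submodule.sub_starProjection_mem_orthogonal x
      refine (bound _ fun y hy => ?_).trans ?_
      · exact (Submodule.mem_orthogonal _ _).1 hperp y (Submodule.subset_span hy)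
      · gcongr
        have : x - V.starProjection x = Vᗮ.starProjection x := by
          rw [Submodule.starProjection_orthogonal]; simp
        rw [this]
        exact Submodule.norm_starProjection_apply_le _ x
  have hcl : A ∈ closure {f : H →L[ℂ] H | IsCompactOperator f} := by
    rw [Metric.mem_closure_iff]
    intro ε hε
    obtain ⟨P, hP, hn⟩ := key2 (ε / 2) (by positivity)
    exact ⟨P, hP, by rw [dist_eq_norm]; linarith⟩
  rw [isClosed_setOfPred_isCompactOperator.closure_eq] at hcl
  exact hcl
end HilbertPart

theorem ultra_lim_bounded (p : Ultrafilter ℕ) (u : ℕ → ℂ) (K : ℝ) (hu : ∀ N, ‖u N‖ ≤ K) :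
    ∃ z : ℂ, Tendsto u p (𝓝 z) := by
  have hc : IsCompact (Metric.closedBall (0 : ℂ) K) := isCompact_closedBall _ _
  have h2 : (p.map u : Filter ℂ) ≤ 𝓟 (Metric.closedBall (0 : ℂ) K) := by
    rw [le_principal_iff]
    exact Filter.mem_map.2 (Filter.univ_mem' fun N => by simpa using hu N)
  obtain ⟨z, -, hz⟩ := hc.ultrafilter_le_nhds _ h2
  exact ⟨z, hz⟩

section HilbertPart2
variable {H : Type*} [NormedAddCommGroup H] [InnerProductSpace ℂ H] [CompleteSpace H]

theorem weak_mixing_abstract (U : H ≃ₗᵢ[ℂ] H) (v : H)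
    (hv : ∀ (e : H) (l : ℂ), U e = l • e → inner ℂ e v = 0)
    (p : Ultrafilter ℕ) {ι : Type*} (S : ℕ → Finset ι) (e : ι → ℕ) (c : ℕ → ℝ)
    (hc : ∀ N, 0 ≤ c N) (C : ℝ) (hC : ∀ N, c N * (S N).card ≤ C)
    (hinv : ∀ F : ℕ → ℂ, (∃ K, ∀ n, ‖F n‖ ≤ K) →
      Tendsto (fun N => (c N : ℂ) * ∑ q ∈ S N, (F (e q + 1) - F (e q))) p (𝓝 0)) (h : H) :
    Tendsto (fun N => c N * ∑ q ∈ S N, ‖inner ℂ (U^[e q] v) h‖ ^ 2) p (𝓝 0) := by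
  have hC0 : 0 ≤ C := le_trans (mul_nonneg (hc 0) (Nat.cast_nonneg _)) (hC 0)
  have hUn : ∀ n, ‖U^[n] v‖ = ‖v‖ := by
    intro n
    induction n with
    | zero => rfl
    | succ n ih => rw [Function.iterate_succ_apply', U.norm_map, ih]
  let F : H → H → ℕ → ℂ := fun w w' n => inner ℂ w (U^[n] v) * inner ℂ (U^[n] v) w'
  have hF : ∀ w w' n, ‖F w w' n‖ ≤ ‖v‖ ^ 2 * ‖w‖ * ‖w'‖ := by
    intro w w' n
    calc ‖F w w' n‖ = ‖inner ℂ w (U^[n] v)‖ * ‖inner ℂ (U^[n] v) w'‖ := norm_mul _ _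
      _ ≤ (‖w‖ * ‖U^[n] v‖) * (‖U^[n] v‖ * ‖w'‖) := by
          gcongr <;> exact norm_inner_le_norm _ _
      _ = _ := by rw [hUn]; ring
  let D : H → H → ℕ → ℂ := fun w w' N => (c N : ℂ) * ∑ q ∈ S N, F w w' (e q)
  have hD : ∀ w w' N, ‖D w w' N‖ ≤ (C * ‖v‖ ^ 2) * ‖w‖ * ‖w'‖ := by
    intro w w' N
    calc ‖D w w' N‖ = c N * ‖∑ q ∈ S N, F w w' (e q)‖ := by
          simp only [D, norm_mul, Complex.norm_real, Real.norm_of_nonneg (hc N)]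
      _ ≤ c N * ((S N).card * (‖v‖ ^ 2 * ‖w‖ * ‖w'‖)) := by
          gcongr
          · exact hc N
          · calc _ ≤ ∑ q ∈ S N, ‖F w w' (e q)‖ := norm_sum_le _ _
              _ ≤ ∑ q ∈ S N, (‖v‖ ^ 2 * ‖w‖ * ‖w'‖) := Finset.sum_le_sum fun q _ => hF _ _ _
              _ = _ := by simp
      _ = (c N * (S N).card) * (‖v‖ ^ 2 * ‖w‖ * ‖w'‖) := by ring
      _ ≤ C * (‖v‖ ^ 2 * ‖w‖ * ‖w'‖) := by gcongr; exact hC N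
      _ = _ := by ring
  choose B hB using fun w w' => ultra_lim_bounded p (D w w') _ (hD w w')
  have hBuniq : ∀ w w' z, Tendsto (D w w') p (𝓝 z) → B w w' = z := fun w w' z hz =>
    tendsto_nhds_unique (hB w w') hz
  let Bl : H →ₗ⋆[ℂ] H →ₗ[ℂ] ℂ := LinearMap.mk₂'ₛₗ _ _ B
    (by
      intro a b w'
      refine hBuniq _ _ _ (((hB a w').add (hB b w')).congr fun N => ?_)
      simp only [D, F, inner_add_left, add_mul, Finset.sum_add_distrib, mul_add])
    (by
      intro z a w'
      refine hBuniq _ _ _ (((hB a w').const_mul _).congr fun N => ?_)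
      simp only [D, F, inner_smul_left, Finset.mul_sum]
      refine Finset.sum_congr rfl fun q _ => by ring)
    (by
      intro a w w'
      refine hBuniq _ _ _ (((hB a w).add (hB a w')).congr fun N => ?_)
      simp only [D, F, inner_add_right, mul_add, Finset.sum_add_distrib])
    (by
      intro z a w'
      refine hBuniq _ _ _ (((hB a w').const_mul _).congr fun N => ?_)
      simp only [D, F, inner_smul_right, Finset.mul_sum, RingHom.id_apply]
      refine Finset.sum_congr rfl fun q _ => by ring)
  let Bc : H →L⋆[ℂ] H →L[ℂ] ℂ := LinearMap.mkContinuous₂ Bl (C * ‖v‖ ^ 2) (fun x y =>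
    le_of_tendsto (hB x y).norm (Eventually.of_forall fun N => hD x y N))
  let A : H →L[ℂ] H := InnerProductSpace.continuousLinearMapOfBilin Bc
  have hA : ∀ x y, inner ℂ (A x) y = B x y := fun x y =>
    InnerProductSpace.continuousLinearMapOfBilin_apply Bc x y
  -- diagonal values
  let d : H → ℕ → ℝ := fun x N => c N * ∑ q ∈ S N, ‖inner ℂ (U^[e q] v) x‖ ^ 2
  have hFd : ∀ x n, F x x n = ((‖inner ℂ (U^[n] v) x‖ ^ 2 : ℝ) : ℂ) := by
    intro x n
    simp only [F]
    rw [← inner_conj_symm x, Complex.conj_mul']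
    simp
  have hDd : ∀ x N, D x x N = (d x N : ℂ) := by
    intro x N
    simp only [D, d, hFd]
    push_cast
    rfl
  have hd : ∀ x, Tendsto (d x) p (𝓝 (inner ℂ (A x) x).re) := by
    intro x
    have := (Complex.continuous_re.tendsto _).comp (hB x x)
    rw [hA]
    refine this.congr fun N => ?_
    simp [hDd]
  have hd0 : ∀ x N, 0 ≤ d x N := fun x N =>
    mul_nonneg (hc N) (Finset.sum_nonneg fun _ _ => by positivity)
  have hpos : ∀ x, 0 ≤ (inner ℂ (A x) x).re := fun x =>
    ge_of_tendsto (hd x) (Eventually.of_forall (hd0 x))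
  have hcs : ∀ x y, ‖inner ℂ (A x) y‖ ^ 2 ≤ (inner ℂ (A x) x).re * (inner ℂ (A y) y).re := by
    intro x y
    rw [hA]
    refine le_of_tendsto_of_tendsto ((hB x y).norm.pow 2) ((hd x).mul (hd y))
      (Eventually.of_forall fun N => ?_)
    have h1 : ‖D x y N‖ ≤ c N * ∑ q ∈ S N, ‖inner ℂ (U^[e q] v) x‖ * ‖inner ℂ (U^[e q] v) y‖ := by
      simp only [D, norm_mul, Complex.norm_real, Real.norm_of_nonneg (hc N)]
      gcongr
      · exact hc N
      · refine (norm_sum_le _ _).trans (Finset.sum_le_sum fun q _ => ?_)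
        simp only [F]
        rw [norm_mul, norm_inner_symm x]
    calc ‖D x y N‖ ^ 2 ≤ (c N * ∑ q ∈ S N, ‖inner ℂ (U^[e q] v) x‖ * ‖inner ℂ (U^[e q] v) y‖) ^ 2 := by
          gcongr
      _ = c N ^ 2 * (∑ q ∈ S N, ‖inner ℂ (U^[e q] v) x‖ * ‖inner ℂ (U^[e q] v) y‖) ^ 2 := by ring
      _ ≤ c N ^ 2 * ((∑ q ∈ S N, ‖inner ℂ (U^[e q] v) x‖ ^ 2) *
            ∑ q ∈ S N, ‖inner ℂ (U^[e q] v) y‖ ^ 2) := by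
          gcongr
          exact Finset.sum_mul_sq_le_sq_mul_sq _ _ _
      _ = d x N * d y N := by simp only [d]; ring
  have htr : ∀ s : Finset H, Orthonormal ℂ (fun x : s => (x : H)) →
      ∑ x ∈ s, (inner ℂ (A x) x).re ≤ C * ‖v‖ ^ 2 := by
    intro s hs
    refine le_of_tendsto (tendsto_finsetSum s fun x _ => hd x) (Eventually.of_forall fun N => ?_)
    simp only [d]
    rw [← Finset.mul_sum, Finset.sum_comm]
    calc c N * ∑ q ∈ S N, ∑ x ∈ s, ‖inner ℂ (U^[e q] v) x‖ ^ 2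
        ≤ c N * ∑ q ∈ S N, ‖v‖ ^ 2 := by
          gcongr with q hq
          · exact hc N
          · have := hs.sum_inner_products_le (U^[e q] v) (s := Finset.univ)
            rw [hUn] at this
            refine le_trans (le_of_eq ?_) this
            rw [Finset.univ_eq_attach, Finset.sum_attach s (fun x => ‖inner ℂ x (U^[e q] v)‖ ^ 2)]
            exact Finset.sum_congr rfl fun x _ => by rw [norm_inner_symm]
      _ = (c N * (S N).card) * ‖v‖ ^ 2 := by simp; ring
      _ ≤ _ := by gcongr; exact hC N
  have hcomp : IsCompactOperator A := compact_of_trace_bound A hcs hpos _ htr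
  have hsymm : (A : H →ₗ[ℂ] H).IsSymmetric := by
    intro x y
    change inner ℂ (A x) y = inner ℂ x (A y)
    rw [← inner_conj_symm x, hA, hA]
    refine hBuniq _ _ _ (((Complex.continuous_conj.tendsto _).comp (hB y x)).congr fun N => ?_)
    simp only [D, F, Function.comp, map_mul, map_sum, inner_conj_symm, Complex.conj_ofReal]
    congr 1
    exact Finset.sum_congr rfl fun q _ => by ring
  -- commutation
  have hBU : ∀ w w', B (U w) (U w') = B w w' := by
    intro w w'
    have h1 := hinv (F (U w) (U w')) ⟨_, hF (U w) (U w')⟩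
    have h2 : ∀ n, F (U w) (U w') (n + 1) = F w w' n := by
      intro n
      simp only [F]
      rw [Function.iterate_succ_apply', U.inner_map_map, U.inner_map_map]
    simp only [h2] at h1
    refine hBuniq _ _ _ ?_
    have h3 := (hB w w').sub h1
    rw [sub_zero] at h3
    refine h3.congr fun N => ?_
    simp only [D, Finset.sum_sub_distrib]
    ring
  have hAU : ∀ w, A (U w) = U (A w) := by
    intro w
    refine ext_inner_right ℂ fun y => ?_
    obtain ⟨y, rfl⟩ := U.surjective y
    rw [hA, hBU, U.inner_map_map, hA]
  have hA0 : A = 0 := by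
    rw [← ContinuousLinearMap.eq_zero_of_forall_hasEigenvalue_eq_zero hcomp hsymm]
    intro l hl
    by_contra hl0
    have hfd := ContinuousLinearMap.finite_dimensional_eigenspace hcomp l hl0
    let V := Module.End.eigenspace (A : H →ₗ[ℂ] H) l
    have hVm : ∀ x, x ∈ V ↔ A x = l • x := fun x => Module.End.mem_eigenspace_iff
    have hUV : ∀ x ∈ V, (U.toLinearEquiv : H →ₗ[ℂ] H) x ∈ V := by
      intro x hx
      rw [hVm] at hx ⊢
      change A (U x) = l • U x
      rw [hAU, hx, map_smul]
    have hnt : Nontrivial V := (Submodule.nontrivial_iff_ne_bot).2 hl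
    obtain ⟨l', hl'⟩ := Module.End.exists_eigenvalue ((U.toLinearEquiv : H →ₗ[ℂ] H).restrict hUV)
    obtain ⟨x, hx⟩ := hl'.exists_hasEigenvector
    have hx1 : U x = l' • (x : H) := congrArg Subtype.val hx.apply_eq_smul
    have hx0 : (x : H) ≠ 0 := fun h0 => hx.2 (Subtype.ext h0)
    have hlne0 : l' ≠ 0 := by
      rintro rfl
      rw [zero_smul] at hx1
      exact hx0 (by simpa using hx1)
    have hperp : ∀ n, inner ℂ (x : H) (U^[n] v) = 0 := by
      intro n
      induction n with
      | zero => exact hv _ _ hx1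
      | succ n ih =>
        have : (x : H) = l'⁻¹ • U x := by rw [hx1, smul_smul, inv_mul_cancel₀ hlne0, one_smul]
        rw [Function.iterate_succ_apply', this, inner_smul_left, U.inner_map_map, ih, mul_zero]
    have hAx : A x = 0 := by
      refine ext_inner_right ℂ fun y => ?_
      rw [hA, inner_zero_left]
      refine hBuniq _ _ _ (tendsto_const_nhds.congr fun N => ?_)
      simp [D, F, hperp]
    have := (hVm x).1 x.2
    rw [hAx] at this
    exact (smul_ne_zero hl0 hx0) this.symm
  have := hd h
  rw [hA0] at this
  simpa using this
end HilbertPart2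

section GroupPart
open scoped Pointwise
variable {Z : Type*} [CommGroup Z] [TopologicalSpace Z] [IsTopologicalGroup Z] [CompactSpace Z]
  [T2Space Z] [SecondCountableTopology Z] [MeasurableSpace Z] [BorelSpace Z]

theorem trans_diff_small (η : Measure Z) [η.IsHaarMeasure] [IsProbabilityMeasure η]
    {C : Set Z} (hC : MeasurableSet C) {ε : ENNReal} (hε : 0 < ε) :
    ∀ᶠ s in 𝓝 (1 : Z), η (C \ (fun z => z * s) ⁻¹' C) ≤ ε := by
  have hε2 : 0 < ε / 2 := ENNReal.half_pos hε.ne'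
  obtain ⟨k, hkC, hk, hk2⟩ := hC.exists_isCompact_sdiff_lt (measure_ne_top η C) hε2.ne'
  have h1 := (tendsto_measure_smul_sdiff_isCompact_isClosed (μ := η) hk hk.isClosed).eventually
    (gt_mem_nhds hε2)
  filter_upwards [h1] with s hs
  have hsub : C \ (fun z => z * s) ⁻¹' C ⊆ (C \ k) ∪ (fun z => s * z) ⁻¹' (s • k \ k) := by
    intro z hz
    by_cases hzk : z ∈ k
    · right
      refine ⟨⟨z, hzk, rfl⟩, fun h => hz.2 (hkC ?_)⟩
      simpa [mul_comm] using h
    · exact Or.inl ⟨hz.1, hzk⟩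
  calc _ ≤ η (C \ k) + η ((fun z => s * z) ⁻¹' (s • k \ k)) :=
        (measure_mono hsub).trans (measure_union_le _ _)
    _ = η (C \ k) + η (s • k \ k) := by rw [measure_preimage_mul]
    _ ≤ ε / 2 + ε / 2 := add_le_add hk2.le hs.le
    _ = ε := ENNReal.add_halves ε

theorem dense_invariant_unique (η : Measure Z) [η.IsHaarMeasure] [IsProbabilityMeasure η]
    (α : Z) (hα : Dense (Subgroup.zpowers α : Set Z)) (τ : Measure Z) [IsFiniteMeasure τ]
    (hτ : τ.map (fun z => α * z) = τ) : τ = τ Set.univ • η := by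
  have hf : ∀ (f : BoundedContinuousFunction Z ℝ) (g : Z), ∫ z, f (g * z) ∂τ = ∫ z, f z ∂τ := by
    intro f
    have h1 : ∀ g, ∫ z, f ((α * g) * z) ∂τ = ∫ z, f (g * z) ∂τ := by
      intro g
      conv_rhs => rw [← hτ]
      rw [integral_map (by fun_prop)]
      · simp only [mul_comm α g, mul_assoc]
      · exact (f.continuous.comp (continuous_const.mul continuous_id)).aestronglyMeasurable
    have h3 : ∀ n : ℤ, ∫ z, f ((α ^ n) * z) ∂τ = ∫ z, f z ∂τ := by
      intro n
      induction n with
      | zero => simp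
      | succ n ih => rw [zpow_add_one, mul_comm _ α, h1, ih]
      | pred n ih => rw [← ih, ← h1, mul_comm α, ← zpow_add_one, sub_add_cancel]
    have hcont : Continuous fun g : Z => ∫ z, f (g * z) ∂τ := by
      refine continuous_of_dominated (bound := fun _ => ‖f‖) ?_ ?_ (integrable_const _) ?_
      · intro g
        exact (f.continuous.comp (continuous_const.mul continuous_id)).aestronglyMeasurable
      · intro g
        exact Eventually.of_forall fun z => f.norm_coe_le_norm _
      · exact Eventually.of_forall fun z => f.continuous.comp (by fun_prop)
    intro g
    refine congrFun (hcont.ext_on hα continuous_const ?_) g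
    rintro _ ⟨n, rfl⟩
    exact h3 n
  have hinv : τ.IsMulLeftInvariant := by
    constructor
    intro g
    have : IsFiniteMeasure (τ.map (fun z => g * z)) := Measure.isFiniteMeasure_map _ _
    refine ext_of_forall_integral_eq_of_IsFiniteMeasure fun f => ?_
    rw [integral_map (by fun_prop) f.continuous.aestronglyMeasurable]
    exact hf f g
  have h := Measure.isMulLeftInvariant_eq_smul τ η
  have h2 : τ Set.univ = (Measure.haarScalarFactor τ η : ENNReal) := by
    have h3 := congrArg (fun ν : Measure Z => ν Set.univ) h
    refine h3.trans ?_
    rw [Measure.smul_apply, measure_univ, ENNReal.smul_def, smul_eq_mul, mul_one]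
  rw [h2]
  exact h

theorem pow_invariant_le (η : Measure Z) [η.IsHaarMeasure] [IsProbabilityMeasure η]
    (α : Z) (hα : Dense (Subgroup.zpowers α : Set Z)) (ρ : Measure Z) [IsProbabilityMeasure ρ]
    (d : ℕ) (hd : 0 < d)
    (hρ : ρ.map (fun z => α ^ d * z) = ρ) : ρ ≤ (d : ENNReal) • η := by
  let τ : Measure Z := ∑ i ∈ Finset.range d, ρ.map (fun z => α ^ i * z)
  have hm : ∀ i, IsProbabilityMeasure (ρ.map (fun z => α ^ i * z)) := fun i =>
    Measure.isProbabilityMeasure_map (by fun_prop)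
  have h1 : τ.map (fun z => α * z) = τ := by
    have : τ.map (fun z => α * z) = ∑ i ∈ Finset.range d, ρ.map (fun z => α ^ (i + 1) * z) := by
      ext s hs
      rw [Measure.map_apply (by fun_prop) hs]
      simp only [τ, Measure.finsetSum_apply]
      refine Finset.sum_congr rfl fun i _ => ?_
      rw [Measure.map_apply (by fun_prop) (by measurability), Measure.map_apply (by fun_prop) hs]
      congr 1
      ext z
      simp [pow_succ', mul_assoc]
    rw [this]
    obtain ⟨e, rfl⟩ : ∃ e, d = e + 1 := ⟨d - 1, by omega⟩
    simp only [τ]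
    rw [Finset.sum_range_succ, Finset.sum_range_succ', hρ]
    simp
  have hτ1 : τ Set.univ = d := by
    simp [τ, Measure.finsetSum_apply]
  have hfin : IsFiniteMeasure τ := ⟨by rw [hτ1]; exact ENNReal.natCast_lt_top d⟩
  have h2 := dense_invariant_unique η α hα τ h1
  rw [hτ1] at h2
  rw [← h2]
  have : ρ = ρ.map (fun z => α ^ 0 * z) := by simp
  rw [this]
  exact Finset.single_le_sum (f := fun i => ρ.map (fun z => α ^ i * z)) (fun i _ => Measure.zero_le _) (Finset.mem_range.2 hd)

end GroupPart

section TransferPart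
variable {Z : Type*} [CommGroup Z] [TopologicalSpace Z] [IsTopologicalGroup Z] [CompactSpace Z]
  [T2Space Z] [SecondCountableTopology Z] [MeasurableSpace Z] [BorelSpace Z]

theorem bad_transfer {X : Type*} [MeasurableSpace X] (μ : Measure X) [IsProbabilityMeasure μ]
    (η : Measure Z) [η.IsHaarMeasure] [IsProbabilityMeasure η] (π : X → Z) (hπ : Measurable π)
    (κ : Measure (X × Z)) [IsProbabilityMeasure κ] (m c d : ℕ)
    (hac : κ.map Prod.fst ≪ μ)
    (h1 : κ.map (fun p => π p.1) ≤ (c : ENNReal) • η)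
    (h2 : κ.map (fun p => π p.1 * p.2 ^ m) ≤ (d : ENNReal) • η)
    (V B : Set X) (hV : MeasurableSet V) (hB : MeasurableSet B) (hBV : B ⊆ V)
    (P : Set Z) (hP : MeasurableSet P)
    (hz : ∀ᵐ p ∂κ, p.1 ∈ V → ∀ᵐ x ∂μ, x ∈ B → π x * p.2 ^ m ∉ P) :
    ∀ᵐ p ∂κ, p.1 ∈ B → π p.1 * p.2 ^ m ∉ P := by
  have hS : MeasurableSet {q : Z × (X × Z) | q.2.1 ∈ V ∧ q.1 * q.2.2 ^ m ∈ P} := by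
    apply MeasurableSet.inter
    · exact (measurable_fst.comp measurable_snd) hV
    · have : Measurable fun q : Z × (X × Z) => q.1 * q.2.2 ^ m := by fun_prop
      exact this hP
  let C : Set Z := {z | κ {p | p.1 ∈ V ∧ z * p.2 ^ m ∈ P} = 0}
  have hC : MeasurableSet C := (measurable_measure_prodMk_left hS) (measurableSet_singleton 0)
  -- almost every point of B is sent to C
  have hBC : ∀ᵐ x ∂μ, x ∈ B → π x ∈ C := by
    have h3 : ∀ᵐ p ∂κ, ∀ᵐ x ∂μ, (x ∈ B → p.1 ∈ V → π x * p.2 ^ m ∉ P) := by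
      filter_upwards [hz] with p hp
      by_cases hpV : p.1 ∈ V
      · filter_upwards [hp hpV] with x hx h _ using hx h
      · exact Eventually.of_forall fun x _ h => absurd h hpV
    rw [Measure.ae_ae_comm] at h3
    · filter_upwards [h3] with x hx hxB
      have : ∀ᵐ p ∂κ, ¬ (p.1 ∈ V ∧ π x * p.2 ^ m ∈ P) := by
        filter_upwards [hx] with p hp h using hp hxB h.1 h.2
      simpa [C] using ae_iff.1 this
    · have hm1 : Measurable fun q : (X × Z) × X => π q.2 * q.1.2 ^ m := by fun_prop
      have e : {q : (X × Z) × X | q.2 ∈ B → q.1.1 ∈ V → π q.2 * q.1.2 ^ m ∉ P}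
        = ((fun q : (X × Z) × X => q.2) ⁻¹' B ∩ ((fun q : (X × Z) × X => q.1.1) ⁻¹' V ∩
            (fun q : (X × Z) × X => π q.2 * q.1.2 ^ m) ⁻¹' P))ᶜ := by
        ext q; simp
      have hh := ((measurable_snd hB).inter (((measurable_fst.comp measurable_fst) hV).inter
        (hm1 hP))).compl
      exact e ▸ hh
  have hBC' : ∀ᵐ p ∂κ, p.1 ∈ B → π p.1 ∈ C := by
    exact ae_of_ae_map measurable_fst.aemeasurable (hac.ae_le hBC)
  -- the translated event vanishes for almost every translation
  have hI : ∀ᵐ s ∂η, ∀ᵐ p ∂κ, ¬ (p.1 ∈ V ∧ π p.1 * s ∈ C ∧ π p.1 * s * p.2 ^ m ∈ P) := by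
    have hm2 : MeasurableSet {q : Z × (X × Z) | ¬ (q.2.1 ∈ V ∧ π q.2.1 * q.1 ∈ C ∧
        π q.2.1 * q.1 * q.2.2 ^ m ∈ P)} := by
      have ha : Measurable fun q : Z × (X × Z) => π q.2.1 * q.1 := by fun_prop
      have hb : Measurable fun q : Z × (X × Z) => π q.2.1 * q.1 * q.2.2 ^ m := by fun_prop
      exact (((measurable_fst.comp measurable_snd) hV).inter ((ha hC).inter (hb hP))).compl
    rw [Measure.ae_ae_comm hm2]
    have h4 : ∀ᵐ p ∂κ, ∀ᵐ s ∂η, ¬ (p.1 ∈ V ∧ s ∈ C ∧ s * p.2 ^ m ∈ P) := by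
      have hm3 : MeasurableSet {q : (X × Z) × Z | ¬ (q.1.1 ∈ V ∧ q.2 ∈ C ∧
        q.2 * q.1.2 ^ m ∈ P)} := by
        have hb : Measurable fun q : (X × Z) × Z => q.2 * q.1.2 ^ m := by fun_prop
        exact (((measurable_fst.comp measurable_fst) hV).inter
          ((measurable_snd hC).inter (hb hP))).compl
      rw [Measure.ae_ae_comm hm3]
      refine Eventually.of_forall fun s => ?_
      by_cases hs : s ∈ C
      · have : ∀ᵐ p ∂κ, ¬ (p.1 ∈ V ∧ s * p.2 ^ m ∈ P) := by
          rw [ae_iff]; simpa [C] using hs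
        filter_upwards [this] with p hp h using hp ⟨h.1, h.2.2⟩
      · exact Eventually.of_forall fun p h => hs h.2.1
    filter_upwards [h4] with p hp
    exact (measurePreserving_mul_left η (π p.1)).quasiMeasurePreserving.ae hp
  -- conclusion
  rw [ae_iff]
  have hmain : ∀ ε : ENNReal, 0 < ε →
      κ {p | ¬ (p.1 ∈ B → π p.1 * p.2 ^ m ∉ P)} ≤ c * ε + d * ε := by
    intro ε hε
    have ev := (trans_diff_small η hC hε).and (trans_diff_small η hP hε)
    obtain ⟨s, ⟨hs1, hs2⟩, hs3⟩ : ∃ s, (η (C \ (fun z => z * s) ⁻¹' C) ≤ ε ∧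
        η (P \ (fun z => z * s) ⁻¹' P) ≤ ε) ∧
        ∀ᵐ p ∂κ, ¬ (p.1 ∈ V ∧ π p.1 * s ∈ C ∧ π p.1 * s * p.2 ^ m ∈ P) := by
      by_contra hcon
      have hpos := Measure.measure_pos_of_mem_nhds η ev
      refine hpos.ne' (measure_mono_null ?_ (ae_iff.1 hI))
      intro s hs
      exact fun h => hcon ⟨s, hs, h⟩
    have hsub : {p : X × Z | ¬ (p.1 ∈ B → π p.1 * p.2 ^ m ∉ P)} ⊆
        ({p | ¬ (p.1 ∈ B → π p.1 ∈ C)} ∪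
          {p | ¬ ¬ (p.1 ∈ V ∧ π p.1 * s ∈ C ∧ π p.1 * s * p.2 ^ m ∈ P)}) ∪
        ((fun p : X × Z => π p.1) ⁻¹' (C \ (fun z => z * s) ⁻¹' C) ∪
          (fun p : X × Z => π p.1 * p.2 ^ m) ⁻¹' (P \ (fun z => z * s) ⁻¹' P)) := by
      intro p hp
      simp only [Set.mem_ofPred_eq, Set.mem_union, Set.mem_preimage, Set.mem_sdiff] at hp ⊢
      have e : π p.1 * p.2 ^ m * s = π p.1 * s * p.2 ^ m := by
        rw [mul_assoc, mul_comm _ s, mul_assoc]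
      rw [e]
      have := @hBV p.1
      tauto
    have hm4 : Measurable fun p : X × Z => π p.1 := by fun_prop
    have hm5 : Measurable fun p : X × Z => π p.1 * p.2 ^ m := by fun_prop
    have hms : Measurable fun z : Z => z * s := by fun_prop
    refine (measure_mono hsub).trans ((measure_union_le _ _).trans ?_)
    rw [measure_union_null (ae_iff.1 hBC') (ae_iff.1 hs3), zero_add]
    refine (measure_union_le _ _).trans (add_le_add ?_ ?_)
    · rw [← Measure.map_apply hm4 (hC.diff (hms hC))]
      exact (h1 _).trans (by simpa using mul_le_mul_right hs1 _)
    · rw [← Measure.map_apply hm5 (hP.diff (hms hP))]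
      exact (h2 _).trans (by simpa using mul_le_mul_right hs2 _)
  have hlim : Tendsto (fun ε : ENNReal => c * ε + d * ε) (𝓝[>] 0) (𝓝 (c * 0 + d * 0)) := by
    refine Tendsto.mono_left ?_ nhdsWithin_le_nhds
    exact (ENNReal.Tendsto.const_mul tendsto_id (Or.inr (ENNReal.natCast_ne_top c))).add
      (ENNReal.Tendsto.const_mul tendsto_id (Or.inr (ENNReal.natCast_ne_top d)))
  have : κ {p | ¬ (p.1 ∈ B → π p.1 * p.2 ^ m ∉ P)} ≤ c * 0 + d * 0 :=
    ge_of_tendsto hlim (by filter_upwards [self_mem_nhdsWithin] with ε hε using hmain ε hε)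
  simpa using this

end TransferPart

section FolnerPart

theorem folner_card {Φ : ℕ → Finset ℕ} (hΦ : IsFolnerSeq Φ) :
    Tendsto (fun N => (1 : ℝ) / (Φ N).card) atTop (𝓝 0) := by
  have h := (hΦ.2 1).const_sub 1
  rw [sub_self] at h
  refine squeeze_zero (fun N => by positivity) (fun N => ?_) h
  have hne := hΦ.1 N
  have hpos : (0 : ℝ) < (Φ N).card := by exact_mod_cast hne.card_pos
  have hsub : Φ N ∩ (Φ N).image (fun n => 1 + n) ⊆ (Φ N).erase ((Φ N).min' hne) := by
    intro x hx
    rw [Finset.mem_inter, Finset.mem_image] at hx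
    obtain ⟨hx, y, hy, rfl⟩ := hx
    rw [Finset.mem_erase]
    refine ⟨?_, hx⟩
    have := (Φ N).min'_le y hy
    omega
  have hc := Finset.card_le_card hsub
  rw [Finset.card_erase_of_mem (Finset.min'_mem _ _)] at hc
  have hc2 : (((Φ N ∩ (Φ N).image (fun n => 1 + n)).card : ℝ)) + 1 ≤ (Φ N).card := by
    have := hne.card_pos
    exact_mod_cast (by omega :
      (Φ N ∩ (Φ N).image (fun n => 1 + n)).card + 1 ≤ (Φ N).card)
  rw [le_sub_iff_add_le, ← add_div, div_le_one hpos]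
  linarith

theorem folner_shift {Φ : ℕ → Finset ℕ} (hΦ : IsFolnerSeq Φ) {E : Type*} [NormedAddCommGroup E]
    [NormedSpace ℝ E] (t : ℕ) (F : ℕ → E) (K : ℝ) (hF : ∀ n, ‖F n‖ ≤ K) :
    Tendsto (fun N => ((Φ N).card : ℝ)⁻¹ • ∑ k ∈ Φ N, (F (k + t) - F k)) atTop (𝓝 0) := by
  have h := ((hΦ.2 t).const_sub 1).const_mul (2 * K)
  rw [sub_self, mul_zero] at h
  refine squeeze_zero_norm (fun N => ?_) h
  have hne := hΦ.1 N
  have hpos : (0 : ℝ) < (Φ N).card := by exact_mod_cast hne.card_pos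
  set I := (Φ N).image (fun n => t + n) with hI
  have hIc : I.card = (Φ N).card := Finset.card_image_of_injective _ (add_right_injective t)
  have e1 : ∑ k ∈ Φ N, (F (k + t) - F k) = ∑ k ∈ I \ Φ N, F k - ∑ k ∈ Φ N \ I, F k := by
    rw [Finset.sum_sub_distrib]
    have : ∑ k ∈ Φ N, F (k + t) = ∑ k ∈ I, F k := by
      rw [hI, Finset.sum_image (fun _ _ _ _ h => add_right_injective t h)]
      simp [add_comm]
    rw [this, ← Finset.sum_inter_add_sum_sdiff I (Φ N), ← Finset.sum_inter_add_sum_sdiff (Φ N) I,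
      Finset.inter_comm]
    abel
  have hb : ∀ s : Finset ℕ, ‖∑ k ∈ s, F k‖ ≤ s.card * K := by
    intro s
    refine (norm_sum_le_of_le s fun k _ => hF k).trans ?_
    simp
  have c1 : ((Φ N \ I).card : ℝ) = (Φ N).card - (Φ N ∩ I).card := by
    rw [eq_sub_iff_add_eq]
    exact_mod_cast Finset.card_sdiff_add_card_inter _ _
  have c2 : ((I \ Φ N).card : ℝ) = (Φ N).card - (Φ N ∩ I).card := by
    rw [eq_sub_iff_add_eq, ← hIc, Finset.inter_comm]
    exact_mod_cast Finset.card_sdiff_add_card_inter _ _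
  rw [norm_smul, e1, norm_inv, Real.norm_of_nonneg hpos.le]
  calc _ ≤ ((Φ N).card : ℝ)⁻¹ * (((I \ Φ N).card) * K + ((Φ N \ I).card) * K) := by
        gcongr
        exact (norm_sub_le _ _).trans (add_le_add (hb _) (hb _))
    _ = _ := by
        rw [c1, c2]
        field_simp
        ring

end FolnerPart

section KappaPart

theorem measure_le_of_integral_le {X : Type*} [MetricSpace X] [CompactSpace X]
    [MeasurableSpace X] [BorelSpace X] (ρ μ : Measure X) [IsFiniteMeasure ρ] [IsFiniteMeasure μ]
    (c : ℕ) (h : ∀ f : C(X, ℝ), (∀ x, 0 ≤ f x) → ∫ x, f x ∂ρ ≤ c * ∫ x, f x ∂μ) :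
    ρ ≤ (c : ENNReal) • μ := by
  have hcl : ∀ F : Set X, IsClosed F → ρ F ≤ c * μ F := by
    intro F hF
    have h1 := HasOuterApproxClosed.tendsto_lintegral_apprSeq hF ρ
    have h2 := ENNReal.Tendsto.const_mul (HasOuterApproxClosed.tendsto_lintegral_apprSeq hF μ)
      (Or.inr (ENNReal.natCast_ne_top c))
    refine le_of_tendsto_of_tendsto' h1 h2 fun n => ?_
    let g : C(X, ℝ) := ⟨fun x => (hF.apprSeq n x : ℝ), by fun_prop⟩
    have hg0 : ∀ x, 0 ≤ g x := fun x => NNReal.coe_nonneg _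
    have h3 : ∀ ν : Measure X, IsFiniteMeasure ν →
        ∫⁻ x, hF.apprSeq n x ∂ν = ENNReal.ofReal (∫ x, g x ∂ν) := by
      intro ν hν
      rw [ofReal_integral_eq_lintegral_ofReal]
      · simp [g]
      · exact g.continuous.integrable_of_hasCompactSupport (HasCompactSupport.of_compactSpace _)
      · exact Eventually.of_forall hg0
    rw [h3 ρ inferInstance, h3 μ inferInstance]
    calc _ ≤ ENNReal.ofReal (c * ∫ x, g x ∂μ) := ENNReal.ofReal_le_ofReal (h g hg0)
      _ = _ := by rw [ENNReal.ofReal_mul (Nat.cast_nonneg c), ENNReal.ofReal_natCast]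
  refine Measure.le_iff.2 fun s hs => ?_
  rw [hs.measure_eq_iSup_isClosed_of_ne_top (measure_ne_top ρ s)]
  refine iSup_le fun F => iSup_le fun hFs => iSup_le fun hF => ?_
  refine (hcl F hF).trans ?_
  simpa using mul_le_mul_right (measure_mono (μ := μ) hFs) (c : ENNReal)

theorem exists_limit_measure {Y : Type*} [TopologicalSpace Y] [T2Space Y] [CompactSpace Y]
    [MeasurableSpace Y] [BorelSpace Y] (p : Ultrafilter ℕ) (y : ℕ → Y)
    (Φ : ℕ → Finset ℕ) (hΦ : ∀ N, (Φ N).Nonempty) :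
    ∃ κ : Measure Y, IsProbabilityMeasure κ ∧ ∀ f : C(Y, ℝ),
      Tendsto (fun N => ((Φ N).card : ℝ)⁻¹ • ∑ k ∈ Φ N, f (y k)) p (𝓝 (∫ z, f z ∂κ)) := by
  have hpr : ∀ N, IsProbabilityMeasure
      (((Φ N).card : ENNReal)⁻¹ • ∑ k ∈ Φ N, Measure.dirac (y k)) := by
    intro N
    constructor
    rw [Measure.smul_apply, Measure.finsetSum_apply]
    simp only [measure_univ, Finset.sum_const, nsmul_eq_mul, mul_one, smul_eq_mul]
    exact ENNReal.inv_mul_cancel (by simpa using (hΦ N).ne_empty) (ENNReal.natCast_ne_top _)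
  let ν : ℕ → ProbabilityMeasure Y := fun N => ⟨_, hpr N⟩
  obtain ⟨κ, -, hκ⟩ := isCompact_univ.ultrafilter_le_nhds (p.map ν) (by simp)
  refine ⟨κ, inferInstance, fun f => ?_⟩
  have h1 : Tendsto ν p (𝓝 κ) := hκ
  rw [ProbabilityMeasure.tendsto_iff_forall_integral_tendsto] at h1
  refine (h1 (BoundedContinuousFunction.mkOfCompact f)).congr fun N => ?_
  change ∫ z, f z ∂(((Φ N).card : ENNReal)⁻¹ • ∑ k ∈ Φ N, Measure.dirac (y k)) = _
  rw [integral_smul_measure, integral_finsetSum_measure]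
  · simp [integral_dirac' _ _ f.continuous.stronglyMeasurable]
  · intro k _
    exact f.continuous.integrable_of_hasCompactSupport (HasCompactSupport.of_compactSpace _)

variable {Z : Type*} [CommGroup Z] [TopologicalSpace Z] [IsTopologicalGroup Z] [CompactSpace Z]
  [T2Space Z] [SecondCountableTopology Z] [MeasurableSpace Z] [BorelSpace Z]

theorem exists_kappa {X : Type*} [MetricSpace X] [CompactSpace X]
    [MeasurableSpace X] [BorelSpace X] (T : X ≃ₜ X) (μ : Measure X) [IsProbabilityMeasure μ]
    (hT : MeasurePreserving T μ μ) (ℓ : ℕ) (hℓ : 0 < ℓ) (a : X) (Φ : ℕ → Finset ℕ)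
    (hΦ : IsFolnerSeq Φ) (ha : GenericAlong T μ a Φ) (α : Z) (p : Ultrafilter ℕ)
    (hp : (p : Filter ℕ) ≤ atTop) :
    ∃ κ : Measure (X × Z), IsProbabilityMeasure κ ∧ (∀ f : C(X × Z, ℝ),
      Tendsto (fun N => ((Φ N).card : ℝ)⁻¹ • ∑ k ∈ Φ N, f (T^[ℓ * (k / ℓ)] a, α ^ (k / ℓ))) p
        (𝓝 (∫ z, f z ∂κ))) ∧
      κ.map (fun q => (T^[ℓ] q.1, α * q.2)) = κ ∧ κ.map Prod.fst ≤ (ℓ : ENNReal) • μ := by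
  obtain ⟨κ, hκ, hlim⟩ := exists_limit_measure p
    (fun k => ((T^[ℓ * (k / ℓ)] a, α ^ (k / ℓ)) : X × Z)) Φ hΦ.1
  refine ⟨κ, hκ, hlim, ?_, ?_⟩
  · have hTc : Continuous (T^[ℓ]) := T.continuous.iterate ℓ
    have hc : Continuous fun q : X × Z => (T^[ℓ] q.1, α * q.2) := by fun_prop
    have : IsFiniteMeasure (κ.map (fun q => (T^[ℓ] q.1, α * q.2))) :=
      Measure.isFiniteMeasure_map _ _
    refine ext_of_forall_integral_eq_of_IsFiniteMeasure fun f => ?_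
    rw [integral_map hc.aemeasurable f.continuous.aestronglyMeasurable]
    have h1 := hlim ⟨fun q => f (T^[ℓ] q.1, α * q.2), f.continuous.comp hc⟩
    have h2 := hlim f.toContinuousMap
    have h3 := (folner_shift hΦ ℓ (fun k => f (T^[ℓ * (k / ℓ)] a, α ^ (k / ℓ))) ‖f‖
      (fun n => f.norm_coe_le_norm _)).mono_left hp
    have h4 := h1.sub h2
    have h5 := tendsto_nhds_unique (h4.congr fun N => ?_) h3
    · exact sub_eq_zero.1 h5
    · rw [← smul_sub, ← Finset.sum_sub_distrib]
      congr 1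
      refine Finset.sum_congr rfl fun k _ => ?_
      rw [Nat.add_div_right k hℓ]
      congr 1
      change f (T^[ℓ] (T^[ℓ * (k / ℓ)] a), α * α ^ (k / ℓ)) = _
      rw [← Function.iterate_add_apply, pow_succ', mul_add, mul_one, add_comm ℓ]
  · have : IsFiniteMeasure (κ.map (Prod.fst : X × Z → X)) := Measure.isFiniteMeasure_map _ _
    refine measure_le_of_integral_le _ μ ℓ fun f hf => ?_
    rw [integral_map measurable_fst.aemeasurable f.continuous.aestronglyMeasurable]
    have h1 := hlim ⟨fun q => f q.1, f.continuous.comp continuous_fst⟩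
    have hr : ∀ r : ℕ, Tendsto (fun N => ((Φ N).card : ℝ)⁻¹ •
        ∑ k ∈ Φ N, f (T.symm^[r] (T^[k] a))) p (𝓝 (∫ x, f x ∂μ)) := by
      intro r
      have hc : Continuous (T.symm^[r]) := T.symm.continuous.iterate r
      have hmp : MeasurePreserving (T.symm^[r]) μ μ := by
        have : MeasurePreserving T.toMeasurableEquiv μ μ := hT
        exact (this.symm).iterate r
      have h := (ha ⟨fun x => f (T.symm^[r] x), f.continuous.comp hc⟩).mono_left hp
      have e : ∫ x, f (T.symm^[r] x) ∂μ = ∫ x, f x ∂μ := by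
        conv_rhs => rw [← hmp.map_eq]
        rw [integral_map hc.aemeasurable f.continuous.aestronglyMeasurable]
      simp only [ContinuousMap.coe_mk] at h
      rw [e] at h
      refine h.congr fun N => ?_
      rw [div_eq_inv_mul, smul_eq_mul]
    have hs := tendsto_finsetSum (Finset.range ℓ) (fun r _ => hr r)
    simp only [Finset.sum_const, Finset.card_range, nsmul_eq_mul] at hs
    refine le_of_tendsto_of_tendsto' h1 hs fun N => ?_
    rw [← Finset.smul_sum, Finset.sum_comm]
    simp only [smul_eq_mul, ContinuousMap.coe_mk]
    gcongr with k hk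
    have hlt : k % ℓ ∈ Finset.range ℓ := Finset.mem_range.2 (Nat.mod_lt _ hℓ)
    have e : T^[ℓ * (k / ℓ)] a = T.symm^[k % ℓ] (T^[k] a) := by
      have h6 : Function.LeftInverse (T.symm^[k % ℓ]) (T^[k % ℓ]) :=
        Function.LeftInverse.iterate T.symm_apply_apply _
      conv_rhs => rw [← Nat.mod_add_div k ℓ, Function.iterate_add_apply]
      rw [Nat.mod_add_div k ℓ, h6]
    rw [e]
    exact Finset.single_le_sum (f := fun r => f (T.symm^[r] (T^[k] a))) (fun r _ => hf _) hlt

end KappaPart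

section ContPart
variable {Z : Type*} [CommGroup Z] [TopologicalSpace Z] [IsTopologicalGroup Z] [CompactSpace Z]
  [T2Space Z] [SecondCountableTopology Z] [MeasurableSpace Z] [BorelSpace Z]

theorem continuous_translate_integral {X : Type*} [MeasurableSpace X] (μ : Measure X)
    [IsProbabilityMeasure μ]
    (η : Measure Z) [η.IsHaarMeasure] [IsProbabilityMeasure η] (π : X → Z) (hπ : Measurable π)
    (hπη : μ.map π = η) (G : Z → ℝ) (hG : Measurable G) (hG1 : ∀ z, ‖G z‖ ≤ 1) (B : Set X) (m : ℕ) :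
    Continuous fun u : Z => ∫ x in B, G (π x * u ^ m) ∂μ := by
  have hGi : Integrable G η := Integrable.of_bound hG.aestronglyMeasurable 1 (Eventually.of_forall hG1)
  refine continuous_of_uniform_approx_of_continuous fun W hW => ?_
  obtain ⟨ε, hε, hεW⟩ := Metric.mem_uniformity_dist.1 hW
  obtain ⟨g, hg, hgi⟩ := hGi.exists_boundedContinuous_integral_sub_le (half_pos hε)
  refine ⟨fun u => ∫ x in B, g (π x * u ^ m) ∂μ, ?_, fun u => hεW ?_⟩
  · refine continuous_of_dominated (bound := fun _ => ‖g‖) ?_ ?_ (integrable_const _) ?_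
    · intro u
      exact (g.continuous.measurable.comp (hπ.mul_const _)).aestronglyMeasurable
    · intro u
      exact Eventually.of_forall fun z => g.norm_coe_le_norm _
    · exact Eventually.of_forall fun z => g.continuous.comp (by fun_prop)
  · have hmp : MeasurePreserving (fun x => π x * u ^ m) μ η :=
      (measurePreserving_mul_right η (u ^ m)).comp ⟨hπ, hπη⟩
    have i1 : Integrable (fun x => G (π x * u ^ m)) μ := hmp.integrable_comp_of_integrable hGi
    have i2 : Integrable (fun x => g (π x * u ^ m)) μ := hmp.integrable_comp_of_integrable hgi
    rw [Real.dist_eq, ← integral_sub i1.integrableOn i2.integrableOn]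
    calc _ ≤ ∫ x in B, ‖G (π x * u ^ m) - g (π x * u ^ m)‖ ∂μ := norm_integral_le_integral_norm _
      _ ≤ ∫ x, ‖G (π x * u ^ m) - g (π x * u ^ m)‖ ∂μ :=
        setIntegral_le_integral (i1.sub i2).norm (Eventually.of_forall fun _ => norm_nonneg _)
      _ = ∫ z, ‖G z - g z‖ ∂η := by
        rw [← hmp.map_eq, integral_map hmp.measurable.aemeasurable]
        exact (hG.sub g.continuous.measurable).norm.aestronglyMeasurable
      _ < ε := by linarith
end ContPart

section CorePart

theorem avg_eventually_zero {Φ : ℕ → Finset ℕ} (hΦ : IsFolnerSeq Φ) (F : ℕ → ℝ) (R : ℝ)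
    (hF : ∀ k, ‖F k‖ ≤ R) (M : ℕ) (hM : ∀ k, M ≤ k → F k = 0) :
    Tendsto (fun N => ((Φ N).card : ℝ)⁻¹ • ∑ k ∈ Φ N, F k) atTop (𝓝 0) := by
  have h := (folner_card hΦ).mul_const (M * R)
  rw [zero_mul] at h
  have hR : 0 ≤ R := (norm_nonneg _).trans (hF 0)
  refine squeeze_zero_norm (fun N => ?_) h
  rw [norm_smul, norm_inv, Real.norm_of_nonneg (Nat.cast_nonneg _), one_div]
  gcongr
  calc ‖∑ k ∈ Φ N, F k‖ ≤ ∑ k ∈ Φ N, ‖F k‖ := norm_sum_le _ _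
    _ = ∑ k ∈ Φ N with k < M, ‖F k‖ := by
      rw [Finset.sum_filter]
      refine Finset.sum_congr rfl fun k _ => ?_
      split_ifs with hk
      · rfl
      · rw [hM k (by omega), norm_zero]
    _ ≤ ∑ k ∈ Finset.range M, ‖F k‖ := by
      refine Finset.sum_le_sum_of_subset_of_nonneg ?_ fun _ _ _ => norm_nonneg _
      intro k hk
      simpa using (Finset.mem_filter.1 hk).2
    _ ≤ M * R := by
      simpa using Finset.sum_le_sum (s := Finset.range M) fun k _ => hF k

theorem exists_bump {X : Type*} [MetricSpace X] (V : Set X) (hV : IsOpen V) :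
    ∃ f : C(X, ℝ), (∀ x, 0 ≤ f x) ∧ ∀ x, 0 < f x ↔ x ∈ V := by
  rcases Set.eq_empty_or_nonempty Vᶜ with h | h
  · refine ⟨ContinuousMap.const X 1, fun x => by simp, fun x => ?_⟩
    have : x ∈ V := by
      by_contra hx
      exact (Set.eq_empty_iff_forall_notMem.1 h x) hx
    simp [this]
  · refine ⟨⟨fun x => Metric.infDist x Vᶜ, Metric.continuous_infDist_pt _⟩,
      fun x => Metric.infDist_nonneg, fun x => ?_⟩
    have := hV.isClosed_compl.notMem_iff_infDist_pos h (x := x)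
    simpa using this.symm

variable {Z : Type*} [CommGroup Z] [TopologicalSpace Z] [IsTopologicalGroup Z] [CompactSpace Z]
  [T2Space Z] [SecondCountableTopology Z] [MeasurableSpace Z] [BorelSpace Z]

theorem bad_zero {X : Type*} [MetricSpace X] [CompactSpace X]
    [MeasurableSpace X] [BorelSpace X] (T : X ≃ₜ X) (μ : Measure X) [IsProbabilityMeasure μ]
    (ℓ m : ℕ) (hℓ : 0 < ℓ) (a : X) (Φ : ℕ → Finset ℕ)
    (hΦ : IsFolnerSeq Φ) (p : Ultrafilter ℕ) (hp : (p : Filter ℕ) ≤ atTop)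
    (η : Measure Z) [η.IsHaarMeasure] [IsProbabilityMeasure η] (α : Z)
    (π : X → Z) (hπ : Measurable π) (hπη : μ.map π = η)
    (hπn : ∀ n, ∀ᵐ x ∂μ, π (T^[n] x) = α ^ n * π x)
    (K : Set X) (hK : MeasurableSet K) (G : Z → ℝ) (hG : Measurable G) (hG0 : ∀ z, 0 ≤ G z)
    (hG1 : ∀ z, G z ≤ 1)
    (hwm : ∀ (D : Set X), MeasurableSet D → ∀ (w : ℕ → ℝ) (R : ℝ), (∀ k, ‖w k‖ ≤ R) →
      Tendsto (fun N => ((Φ N).card : ℝ)⁻¹ • ∑ k ∈ Φ N, w k * ∫ x in D,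
        (K.indicator (fun _ => (1 : ℝ)) (T^[m * (k / ℓ)] x) - G (π (T^[m * (k / ℓ)] x))) ∂μ) p (𝓝 0))
    (κ : Measure (X × Z)) [IsProbabilityMeasure κ]
    (hκ : ∀ f : C(X × Z, ℝ),
      Tendsto (fun N => ((Φ N).card : ℝ)⁻¹ • ∑ k ∈ Φ N, f (T^[ℓ * (k / ℓ)] a, α ^ (k / ℓ))) p
        (𝓝 (∫ z, f z ∂κ)))
    (V : Set X) (hV : IsOpen V) (B : Set X) (hB : MeasurableSet B)
    (hBad : ∀ x ∈ B, ∀ᶠ n in atTop, ¬ (T^[ℓ * n] a ∈ V ∧ T^[m * n] x ∈ K)) :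
    ∀ᵐ q ∂κ, q.1 ∈ V → ∀ᵐ x ∂μ, x ∈ B → π x * q.2 ^ m ∉ {z | 0 < G z} := by
  obtain ⟨f, hf0, hfV⟩ := exists_bump V hV
  let b : Z → ℝ := fun u => ∫ x in B, G (π x * u ^ m) ∂μ
  have hGn : ∀ z, ‖G z‖ ≤ 1 := fun z => by rw [Real.norm_of_nonneg (hG0 z)]; exact hG1 z
  have hbc : Continuous b := continuous_translate_integral μ η π hπ hπη G hG hGn B m
  have hb0 : ∀ u, 0 ≤ b u := fun u => integral_nonneg fun x => hG0 _
  have hTm : ∀ n, Measurable (T^[n]) := fun n => (T.continuous.iterate n).measurable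
  have hfn : ∀ x, ‖f x‖ ≤ ‖f‖ := fun x => f.norm_coe_le_norm x
  have hind : ∀ x, ‖K.indicator (fun _ => (1 : ℝ)) x‖ ≤ 1 := by
    intro x
    by_cases h : x ∈ K <;> simp [h]
  have mK : ∀ n, Measurable fun x => K.indicator (fun _ => (1 : ℝ)) (T^[n] x) := fun n =>
    (measurable_const.indicator hK).comp (hTm n)
  have iK : ∀ n, Integrable (fun x => K.indicator (fun _ => (1 : ℝ)) (T^[n] x)) (μ.restrict B) :=
    fun n => Integrable.of_bound (mK n).aestronglyMeasurable 1 (Eventually.of_forall fun x => hind _)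
  have iG : ∀ n, Integrable (fun x => G (π (T^[n] x))) (μ.restrict B) :=
    fun n => Integrable.of_bound (hG.comp (hπ.comp (hTm n))).aestronglyMeasurable 1
      (Eventually.of_forall fun x => hGn _)
  -- averages over the indicator vanish
  have s1 : Tendsto (fun N => ((Φ N).card : ℝ)⁻¹ • ∑ k ∈ Φ N, f (T^[ℓ * (k / ℓ)] a) *
      ∫ x in B, K.indicator (fun _ => (1 : ℝ)) (T^[m * (k / ℓ)] x) ∂μ) atTop (𝓝 0) := by
    have hdc : Tendsto (fun N => ∫ x in B, ((Φ N).card : ℝ)⁻¹ • ∑ k ∈ Φ N, f (T^[ℓ * (k / ℓ)] a) *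
      K.indicator (fun _ => (1 : ℝ)) (T^[m * (k / ℓ)] x) ∂μ) atTop (𝓝 (∫ x in B, (0 : ℝ) ∂μ)) := by
      have hnm : ∀ k x, ‖f (T^[ℓ * (k / ℓ)] a) *
          K.indicator (fun _ => (1 : ℝ)) (T^[m * (k / ℓ)] x)‖ ≤ ‖f‖ := by
        intro k x
        rw [norm_mul]
        exact (mul_le_mul (hfn _) (hind _) (norm_nonneg _) (norm_nonneg _)).trans (by rw [mul_one])
      refine tendsto_integral_of_dominated_convergence (fun _ => ‖f‖) ?_ (integrable_const _) ?_ ?_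
      · intro N
        refine Measurable.aestronglyMeasurable ?_
        simp only [smul_eq_mul]
        exact (Finset.measurable_sum _ fun k _ => (mK _).const_mul _).const_mul _
      · intro N
        refine Eventually.of_forall fun x => ?_
        have hpos : (0 : ℝ) < (Φ N).card := by exact_mod_cast (hΦ.1 N).card_pos
        rw [norm_smul, norm_inv, Real.norm_of_nonneg hpos.le, inv_mul_le_iff₀ hpos]
        refine (norm_sum_le_of_le _ fun k _ => hnm k x).trans ?_
        simp
      · filter_upwards [ae_restrict_mem hB] with x hx
        obtain ⟨M, hM⟩ := eventually_atTop.1 (hBad x hx)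
        refine avg_eventually_zero hΦ _ ‖f‖ (fun k => hnm k x) (ℓ * M) fun k hk => ?_
        have hle : M ≤ k / ℓ := (Nat.le_div_iff_mul_le hℓ).2 (by rwa [mul_comm])
        have h3 := hM _ hle
        by_cases hin : T^[m * (k / ℓ)] x ∈ K
        · have hv : T^[ℓ * (k / ℓ)] a ∉ V := fun h => h3 ⟨h, hin⟩
          have : f (T^[ℓ * (k / ℓ)] a) = 0 :=
            le_antisymm (not_lt.1 fun h => hv ((hfV _).1 h)) (hf0 _)
          rw [this, zero_mul]
        · simp [hin]
    rw [integral_zero] at hdc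
    refine hdc.congr fun N => ?_
    rw [integral_smul, integral_finsetSum _ fun k _ => (iK _).const_mul _]
    congr 1
    exact Finset.sum_congr rfl fun k _ => integral_const_mul _ _
  have s2 := hwm B hB (fun k => f (T^[ℓ * (k / ℓ)] a)) ‖f‖ fun k => hfn _
  have s3 := (s1.mono_left hp).sub s2
  rw [sub_zero] at s3
  let fb : C(X × Z, ℝ) := ⟨fun q => f q.1 * b q.2, by fun_prop⟩
  have s4 := hκ fb
  have hzero : ∫ z, fb z ∂κ = 0 := by
    refine tendsto_nhds_unique s4 (s3.congr fun N => ?_)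
    rw [← smul_sub, ← Finset.sum_sub_distrib]
    congr 1
    refine Finset.sum_congr rfl fun k _ => ?_
    rw [integral_sub (iK _) (iG _), ← mul_sub, sub_sub_cancel]
    change _ = f (T^[ℓ * (k / ℓ)] a) * ∫ x in B, G (π x * (α ^ (k / ℓ)) ^ m) ∂μ
    congr 1
    refine integral_congr_ae (ae_restrict_of_ae ?_)
    filter_upwards [hπn (m * (k / ℓ))] with x hx
    rw [hx, mul_comm m, pow_mul, mul_comm]
  have hfb0 : (0 : X × Z → ℝ) ≤ fun q => fb q := fun q => mul_nonneg (hf0 _) (hb0 _)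
  rw [integral_eq_zero_iff_of_nonneg hfb0
    (fb.continuous.integrable_of_hasCompactSupport (HasCompactSupport.of_compactSpace _))] at hzero
  filter_upwards [hzero] with q hq hqV
  have hq2 : f q.1 * b q.2 = 0 := hq
  have hb : b q.2 = 0 := (mul_eq_zero.1 hq2).resolve_left ((hfV _).2 hqV).ne'
  have mG : Measurable fun x => G (π x * q.2 ^ m) := hG.comp (hπ.mul_const _)
  rw [setIntegral_eq_zero_iff_of_nonneg_ae (Eventually.of_forall fun x => hG0 _)
    (Integrable.of_bound mG.aestronglyMeasurable 1 (Eventually.of_forall fun x => hGn _))] at hb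
  rw [EventuallyEq, ae_restrict_iff' hB] at hb
  filter_upwards [hb] with x hx hxB
  have := hx hxB
  simp only [Pi.zero_apply] at this
  simp [this]

end CorePart

section FindPart
variable {Z : Type*} [CommGroup Z] [TopologicalSpace Z] [IsTopologicalGroup Z] [CompactSpace Z]
  [T2Space Z] [SecondCountableTopology Z] [MeasurableSpace Z] [BorelSpace Z]

theorem core_find {X : Type*} [MetricSpace X] [CompactSpace X]
    [MeasurableSpace X] [BorelSpace X] (T : X ≃ₜ X) (μ : Measure X) [IsProbabilityMeasure μ]
    (hT : MeasurePreserving T μ μ)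
    (ℓ m : ℕ) (hℓ : 0 < ℓ) (a : X) (Φ : ℕ → Finset ℕ)
    (hΦ : IsFolnerSeq Φ) (ha : GenericAlong T μ a Φ)
    (p : Ultrafilter ℕ) (hp : (p : Filter ℕ) ≤ atTop)
    (η : Measure Z) [η.IsHaarMeasure] [IsProbabilityMeasure η] (α : Z)
    (hα : Dense (Subgroup.zpowers α : Set Z))
    (π : X → Z) (hπ : Measurable π) (hπT : ∀ᵐ x ∂μ, π (T x) = α * π x)
    (K : Set X) (hK : MeasurableSet K) (G : Z → ℝ) (hG : Measurable G) (hG0 : ∀ z, 0 ≤ G z)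
    (hG1 : ∀ z, G z ≤ 1) (hGK : ∫ x, G (π x) ∂μ = μ.real K)
    (hKl : (ℓ + m : ℝ) * (1 - μ.real K) < 1)
    (hwm : ∀ (D : Set X), MeasurableSet D → ∀ (w : ℕ → ℝ) (R : ℝ), (∀ k, ‖w k‖ ≤ R) →
      Tendsto (fun N => ((Φ N).card : ℝ)⁻¹ • ∑ k ∈ Φ N, w k * ∫ x in D,
        (K.indicator (fun _ => (1 : ℝ)) (T^[m * (k / ℓ)] x) - G (π (T^[m * (k / ℓ)] x))) ∂μ) p (𝓝 0)) :
    ∃ x₁ : X, ∀ U : Set X, IsOpen U → x₁ ∈ U →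
      ∃ᶠ n in atTop, T^[ℓ * n] a ∈ U ∧ T^[m * n] x₁ ∈ K := by
  have hmpn : ∀ n, MeasurePreserving (T^[n]) μ μ := fun n => hT.iterate n
  have hπn : ∀ n, ∀ᵐ x ∂μ, π (T^[n] x) = α ^ n * π x := by
    intro n
    induction n with
    | zero => exact Eventually.of_forall fun x => by simp
    | succ n ih =>
      filter_upwards [ih, (hmpn n).quasiMeasurePreserving.ae hπT] with x h1 h2
      rw [Function.iterate_succ_apply', h2, h1, pow_succ', mul_assoc]
  have hprπ : IsProbabilityMeasure (μ.map π) := Measure.isProbabilityMeasure_map hπ.aemeasurable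
  have hTm : Measurable T := T.continuous.measurable
  have hπη : μ.map π = η := by
    have := dense_invariant_unique η α hα (μ.map π) (by
      rw [Measure.map_map (by fun_prop) hπ]
      have e : (fun z => α * z) ∘ π =ᵐ[μ] π ∘ T := by
        filter_upwards [hπT] with x hx using hx.symm
      rw [Measure.map_congr e, ← Measure.map_map hπ hTm, hT.map_eq])
    rw [this, measure_univ, one_smul]
  obtain ⟨κ, hκp, hκ, hκinv, hκle⟩ := exists_kappa T μ hT ℓ hℓ a Φ hΦ ha α p hp
  have hac : κ.map Prod.fst ≪ μ := Measure.absolutelyContinuous_of_le_smul hκle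
  have h1 : κ.map (fun q => π q.1) ≤ (ℓ : ENNReal) • η := by
    have e : κ.map (fun q => π q.1) = (κ.map Prod.fst).map π :=
      (Measure.map_map hπ measurable_fst).symm
    rw [e, ← hπη, ← Measure.map_smul]
    exact Measure.map_mono hκle hπ
  let ψ : X × Z → Z := fun q => π q.1 * q.2 ^ m
  have hψ : Measurable ψ := by fun_prop
  have hρp : IsProbabilityMeasure (κ.map ψ) := Measure.isProbabilityMeasure_map hψ.aemeasurable
  have h2 : κ.map ψ ≤ ((ℓ + m : ℕ) : ENNReal) • η := by
    refine pow_invariant_le η α hα (κ.map ψ) (ℓ + m) (by omega) ?_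
    rw [Measure.map_map (by fun_prop) hψ]
    have hS : Measurable fun q : X × Z => (T^[ℓ] q.1, α * q.2) :=
      Measurable.prodMk ((hmpn ℓ).measurable.comp measurable_fst) (measurable_snd.const_mul α)
    have e : (fun z => α ^ (ℓ + m) * z) ∘ ψ =ᵐ[κ] ψ ∘ (fun q => (T^[ℓ] q.1, α * q.2)) := by
      filter_upwards [ae_of_ae_map measurable_fst.aemeasurable (hac.ae_le (hπn ℓ))] with q hq
      simp only [Function.comp, ψ]
      rw [hq, pow_add, mul_pow]
      exact mul_mul_mul_comm _ _ _ _
    rw [Measure.map_congr e, ← Measure.map_map hψ hS, hκinv]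
  by_contra hno
  push Not at hno
  let 𝒱 := TopologicalSpace.countableBasis X
  let Bad : Set X → Set X := fun V =>
    {x | x ∈ V ∧ ∀ᶠ n in atTop, ¬ (T^[ℓ * n] a ∈ V ∧ T^[m * n] x ∈ K)}
  have hBadm : ∀ V, IsOpen V → MeasurableSet (Bad V) := by
    intro V hV
    have : Bad V = V ∩ ⋃ M : ℕ, ⋂ n : ℕ, ⋂ _ : M ≤ n,
        {x | ¬ (T^[ℓ * n] a ∈ V ∧ T^[m * n] x ∈ K)} := by
      ext x
      simp [Bad, eventually_atTop]
    rw [this]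
    refine hV.measurableSet.inter (MeasurableSet.iUnion fun M => MeasurableSet.iInter fun n =>
      MeasurableSet.iInter fun _ => ?_)
    by_cases h : T^[ℓ * n] a ∈ V
    · simp only [h, true_and]
      exact ((hmpn _).measurable hK).compl
    · simp [h]
  have hcov : ∀ x : X, ∃ V ∈ 𝒱, x ∈ Bad V := by
    intro x
    obtain ⟨U, hU, hxU, hfreq⟩ := hno x
    obtain ⟨V, hV, hxV, hVU⟩ :=
      (TopologicalSpace.isBasis_countableBasis X).exists_subset_of_mem_open hxU hU
    refine ⟨V, hV, hxV, ?_⟩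
    filter_upwards [hfreq] with n hn h
    exact hn (hVU h.1) h.2
  have hall : ∀ᵐ q ∂κ, ∀ V ∈ 𝒱, q.1 ∈ Bad V → ψ q ∉ {z | 0 < G z} := by
    rw [ae_ball_iff (TopologicalSpace.countable_countableBasis X)]
    intro V hV
    have hVo : IsOpen V := TopologicalSpace.isOpen_of_mem_countableBasis hV
    refine bad_transfer μ η π hπ κ m ℓ (ℓ + m) hac h1 h2 V (Bad V) hVo.measurableSet
      (hBadm V hVo) (fun x hx => hx.1) _ (measurableSet_lt measurable_const hG) ?_
    exact bad_zero T μ ℓ m hℓ a Φ hΦ p hp η α π hπ hπη hπn K hK G hG hG0 hG1 hwm κ hκ V hVo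
      (Bad V) (hBadm V hVo) (fun x hx => hx.2)
  have hall2 : ∀ᵐ q ∂κ, ψ q ∉ {z | 0 < G z} := by
    filter_upwards [hall] with q hq
    obtain ⟨V, hV, hx⟩ := hcov q.1
    exact hq V hV hx
  have hP : MeasurableSet {z | 0 < G z} := measurableSet_lt measurable_const hG
  have hone : (κ.map ψ) {z | 0 < G z}ᶜ = 1 := by
    rw [prob_compl_eq_one_iff hP, Measure.map_apply hψ hP]
    simpa [ae_iff] using hall2
  have hge : (1 : ENNReal) ≤ ((ℓ + m : ℕ) : ENNReal) * η {z | 0 < G z}ᶜ := by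
    rw [← hone]
    simpa using h2 {z | 0 < G z}ᶜ
  have hge2 : (1 : ℝ) ≤ (ℓ + m : ℝ) * η.real {z | 0 < G z}ᶜ := by
    have := ENNReal.toReal_mono (ENNReal.mul_ne_top (ENNReal.natCast_ne_top _)
      (measure_ne_top η _)) hge
    rw [ENNReal.toReal_mul, ENNReal.toReal_natCast, ENNReal.toReal_one, Nat.cast_add] at this
    exact this
  have hGi : Integrable G η := Integrable.of_bound hG.aestronglyMeasurable 1
    (Eventually.of_forall fun z => by rw [Real.norm_of_nonneg (hG0 z)]; exact hG1 z)
  have hle : η.real {z | 0 < G z}ᶜ ≤ 1 - μ.real K := by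
    have e1 : ∫ z, (1 - G z) ∂η = 1 - μ.real K := by
      rw [integral_sub (integrable_const _) hGi, ← hGK]
      simp only [integral_const, probReal_univ, smul_eq_mul, mul_one]
      rw [← hπη, integral_map hπ.aemeasurable hG.aestronglyMeasurable]
    rw [← e1, ← integral_indicator_one hP.compl]
    refine integral_mono ((integrable_const (1 : ℝ)).indicator hP.compl)
      ((integrable_const _).sub hGi) fun z => ?_
    by_cases hz : 0 < G z
    · simp [hz, hG1 z]
    · have : G z = 0 := le_antisymm (not_lt.1 hz) (hG0 z)
      simp [this]
  have : (ℓ + m : ℝ) * η.real {z | 0 < G z}ᶜ ≤ (ℓ + m : ℝ) * (1 - μ.real K) := by gcongr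
  linarith

end FindPart

section ExtractPart

theorem extract_prog {X : Type*} [MetricSpace X] (T : X → X) (ℓ m : ℕ) (a x₁ : X) (K : Set X)
    (hK : IsCompact K)
    (h : ∀ U : Set X, IsOpen U → x₁ ∈ U → ∃ᶠ n in atTop, T^[ℓ * n] a ∈ U ∧ T^[m * n] x₁ ∈ K) :
    ∃ x₂ ∈ K, ErdosProg T ℓ m a x₁ x₂ := by
  have h1 : ∀ i : ℕ, ∃ᶠ n in atTop, 0 < n ∧ dist (T^[ℓ * n] a) x₁ < 1 / ((i : ℝ) + 1) ∧
      T^[m * n] x₁ ∈ K := by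
    intro i
    have h2 := h (Metric.ball x₁ (1 / ((i : ℝ) + 1))) Metric.isOpen_ball
      (Metric.mem_ball_self (by positivity))
    refine (h2.and_eventually (eventually_gt_atTop 0)).mono fun n hn => ?_
    exact ⟨hn.2, hn.1.1, hn.1.2⟩
  obtain ⟨φ, hφ, hP⟩ := extraction_forall_of_frequently h1
  obtain ⟨x₂, hx₂, ψ, hψ, hlim⟩ := hK.tendsto_subseq fun i => (hP i).2.2
  refine ⟨x₂, hx₂, φ ∘ ψ, hφ.comp hψ, fun i => (hP _).1, ?_⟩
  refine Tendsto.prodMk_nhds ?_ hlim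
  have h3 : Tendsto (fun i => T^[ℓ * φ i] a) atTop (𝓝 x₁) := by
    rw [tendsto_iff_dist_tendsto_zero]
    exact squeeze_zero (fun _ => dist_nonneg) (fun i => (hP i).2.1.le)
      tendsto_one_div_add_atTop_nhds_zero_nat
  exact h3.comp hψ.tendsto_atTop

theorem exists_big_compact {X : Type*} [MetricSpace X] [CompactSpace X]
    [MeasurableSpace X] [BorelSpace X]
    (T : X ≃ₜ X) (μ : Measure X) [IsProbabilityMeasure μ] (hT : Ergodic T μ)
    (E : Set X) (hE : IsOpen E) (hEpos : 0 < μ E) (d : ℕ) (hd : 0 < d) :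
    ∃ K : Set X, IsCompact K ∧ (d : ℝ) * (1 - μ.real K) < 1 ∧
      ∀ x ∈ K, ∃ t : ℕ, 0 < t ∧ T^[t] x ∈ E := by
  let W : Set X := ⋃ t : ℕ, T^[t + 1] ⁻¹' E
  have hW : IsOpen W := isOpen_iUnion fun t => hE.preimage (T.continuous.iterate _)
  have hsub : T ⁻¹' W ⊆ W := by
    intro x hx
    obtain ⟨t, ht⟩ := Set.mem_iUnion.1 hx
    exact Set.mem_iUnion.2 ⟨t + 1, by simpa [Function.iterate_succ_apply] using ht⟩
  have hpos : 0 < μ W := by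
    refine lt_of_lt_of_le ?_ (measure_mono (Set.subset_iUnion (fun t : ℕ => T^[t + 1] ⁻¹' E) 0))
    rw [(hT.toMeasurePreserving.iterate 1).measure_preimage hE.measurableSet.nullMeasurableSet]
    exact hEpos
  have hone : μ W = 1 := by
    rcases hT.ae_empty_or_univ_of_preimage_ae_le hW.measurableSet.nullMeasurableSet
      (Eventually.of_forall hsub) with h | h
    · rw [measure_congr h] at hpos
      simp at hpos
    · rw [measure_congr h, measure_univ]
  have hlt : ENNReal.ofReal (1 - 1 / d) < μ W := by
    rw [hone, ENNReal.ofReal_lt_one]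
    have : (0 : ℝ) < 1 / d := by positivity
    linarith
  obtain ⟨K, hKW, hK, hlt2⟩ := hW.exists_lt_isCompact hlt
  refine ⟨K, hK, ?_, fun x hx => ?_⟩
  · have h3 : (1 : ℝ) - 1 / d < μ.real K :=
      (ENNReal.ofReal_lt_iff_lt_toReal (by
        rw [sub_nonneg, div_le_one (by positivity)]
        exact_mod_cast hd) (measure_ne_top μ K)).1 hlt2
    have hd' : (0 : ℝ) < d := by positivity
    calc (d : ℝ) * (1 - μ.real K) < d * (1 / d) := by
          apply mul_lt_mul_of_pos_left _ hd'
          linarith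
      _ = 1 := by field_simp
  · obtain ⟨t, ht⟩ := Set.mem_iUnion.1 (hKW hx)
    exact ⟨t + 1, Nat.succ_pos t, ht⟩

end ExtractPart

section KoopmanPart

theorem exists_koopman {X : Type*} [TopologicalSpace X]
    [MeasurableSpace X] [BorelSpace X] (T : X ≃ₜ X) (μ : Measure X) [IsProbabilityMeasure μ]
    (hT : MeasurePreserving T μ μ) :
    ∃ U : Lp ℂ 2 μ ≃ₗᵢ[ℂ] Lp ℂ 2 μ, ∀ g : Lp ℂ 2 μ, (U g : X → ℂ) =ᵐ[μ] fun x => g (T x) := by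
  have hT' : MeasurePreserving T.symm μ μ := by
    have : MeasurePreserving T.toMeasurableEquiv μ μ := hT
    exact this.symm
  have hsurj : Function.Surjective (Lp.compMeasurePreservingₗᵢ (E := ℂ) (p := 2) ℂ T hT) := by
    intro g
    refine ⟨Lp.compMeasurePreserving T.symm hT' g, ?_⟩
    refine Lp.ext ?_
    change (Lp.compMeasurePreserving T hT (Lp.compMeasurePreserving T.symm hT' g) : X → ℂ) =ᵐ[μ] g
    filter_upwards [Lp.coeFn_compMeasurePreserving (Lp.compMeasurePreserving T.symm hT' g) hT,
      hT.quasiMeasurePreserving.ae (Lp.coeFn_compMeasurePreserving g hT')] with x h1 h2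
    rw [h1, Function.comp, h2, Function.comp, T.symm_apply_apply]
  refine ⟨LinearIsometryEquiv.ofSurjective _ hsurj, fun g => ?_⟩
  exact Lp.coeFn_compMeasurePreserving g hT

theorem hwm_of_orth {X : Type*} [TopologicalSpace X]
    [MeasurableSpace X] [BorelSpace X] (T : X ≃ₜ X) (μ : Measure X) [IsProbabilityMeasure μ]
    (hT : MeasurePreserving T μ μ) (ℓ m : ℕ) (hℓ : 0 < ℓ) (hm : 0 < m) (Φ : ℕ → Finset ℕ)
    (hΦ : IsFolnerSeq Φ) (p : Ultrafilter ℕ) (hp : (p : Filter ℕ) ≤ atTop)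
    (v : X → ℝ) (hvm : Measurable v) (hv1 : ∀ x, ‖v x‖ ≤ 1)
    (hv : ∀ e : X → ℂ, MemLp e 2 μ → ∀ l : ℂ, (∀ᵐ x ∂μ, e (T x) = l * e x) →
      ∫ x, (v x : ℂ) * (starRingEnd ℂ) (e x) ∂μ = 0)
    (D : Set X) (hD : MeasurableSet D) (w : ℕ → ℝ) (R : ℝ) (hw : ∀ k, ‖w k‖ ≤ R) :
    Tendsto (fun N => ((Φ N).card : ℝ)⁻¹ • ∑ k ∈ Φ N, w k * ∫ x in D, v (T^[m * (k / ℓ)] x) ∂μ)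
      p (𝓝 0) := by
  obtain ⟨U, hU⟩ := exists_koopman T μ hT
  have hvL : MemLp (fun x => (v x : ℂ)) 2 μ :=
    MemLp.of_bound (Complex.measurable_ofReal.comp hvm).aestronglyMeasurable 1
      (Eventually.of_forall fun x => by simpa using hv1 x)
  let vL : Lp ℂ 2 μ := hvL.toLp _
  have hvLc : (vL : X → ℂ) =ᵐ[μ] fun x => (v x : ℂ) := hvL.coeFn_toLp
  have hUn : ∀ n, (U^[n] vL : X → ℂ) =ᵐ[μ] fun x => (v (T^[n] x) : ℂ) := by
    intro n
    induction n with
    | zero => simpa using hvLc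
    | succ n ih =>
      rw [Function.iterate_succ_apply']
      filter_upwards [hU (U^[n] vL), hT.quasiMeasurePreserving.ae ih] with x h1 h2
      rw [h1, h2, Function.iterate_succ_apply]
  let h : Lp ℂ 2 μ := indicatorConstLp 2 hD (measure_ne_top μ D) (1 : ℂ)
  have hin : ∀ n, ‖inner ℂ (U^[n] vL) h‖ = ‖∫ x in D, v (T^[n] x) ∂μ‖ := by
    intro n
    rw [norm_inner_symm, L2.inner_indicatorConstLp_one]
    have : ∫ x in D, (U^[n] vL : X → ℂ) x ∂μ = ((∫ x in D, v (T^[n] x) ∂μ : ℝ) : ℂ) := by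
      rw [← integral_complex_ofReal]
      exact integral_congr_ae (ae_restrict_of_ae (hUn n))
    rw [this, Complex.norm_real]
  have horth : ∀ (e : Lp ℂ 2 μ) (l : ℂ), U e = l • e → inner ℂ e vL = 0 := by
    intro e l hel
    rw [L2.inner_def]
    rw [← hv e (Lp.memLp e) l ?_]
    · refine integral_congr_ae ?_
      filter_upwards [hvLc] with x hx
      rw [hx]
      simp [RCLike.inner_apply]
    · have h1 := hU e
      rw [hel] at h1
      filter_upwards [h1, Lp.coeFn_smul l e] with x h2 h3
      rw [← h2, h3]
      rfl
  have hcard : ∀ N, (0 : ℝ) < (Φ N).card := fun N => by exact_mod_cast (hΦ.1 N).card_pos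
  have key := weak_mixing_abstract U vL horth p (fun N => Φ N ×ˢ Finset.range m)
    (fun q => m * (q.1 / ℓ) + q.2) (fun N => ((Φ N).card : ℝ)⁻¹) (fun N => by positivity) m
    (fun N => by
      rw [Finset.card_product, Finset.card_range, Nat.cast_mul, inv_mul_cancel_left₀ (hcard N).ne'])
    (by
      rintro F ⟨K, hK⟩
      have h3 := (folner_shift hΦ ℓ (fun k => F (m * (k / ℓ))) K (fun n => hK _)).mono_left hp
      refine h3.congr fun N => ?_
      rw [Finset.sum_product, Complex.real_smul]
      congr 1
      refine Finset.sum_congr rfl fun k _ => ?_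
      have := Finset.sum_range_sub (fun i => F (m * (k / ℓ) + i)) m
      simp only [← add_assoc, add_zero] at this
      rw [this, Nat.add_div_right k hℓ, mul_add, mul_one]) h
  simp only [hin] at key
  have key2 : Tendsto (fun N => ((Φ N).card : ℝ)⁻¹ *
      ∑ k ∈ Φ N, ‖∫ x in D, v (T^[m * (k / ℓ)] x) ∂μ‖ ^ 2) p (𝓝 0) := by
    refine squeeze_zero (fun N => by positivity) (fun N => ?_) key
    gcongr
    rw [Finset.sum_product]
    refine Finset.sum_le_sum fun k _ => ?_
    exact Finset.single_le_sum (f := fun i => ‖∫ x in D, v (T^[m * (k / ℓ) + i] x) ∂μ‖ ^ 2)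
      (fun i _ => by positivity) (Finset.mem_range.2 hm)
  have key3 := (key2.sqrt).const_mul R
  rw [Real.sqrt_zero, mul_zero] at key3
  have hR : 0 ≤ R := (norm_nonneg _).trans (hw 0)
  refine squeeze_zero_norm (fun N => ?_) key3
  set c : ℕ → ℝ := fun k => ‖∫ x in D, v (T^[m * (k / ℓ)] x) ∂μ‖ with hc
  have hc0 : ∀ k, 0 ≤ c k := fun k => norm_nonneg _
  have hcs : (((Φ N).card : ℝ)⁻¹ * ∑ k ∈ Φ N, c k) ≤
      Real.sqrt (((Φ N).card : ℝ)⁻¹ * ∑ k ∈ Φ N, c k ^ 2) := by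
    apply Real.le_sqrt_of_sq_le
    have := sq_sum_le_card_mul_sum_sq (s := Φ N) (f := c)
    rw [mul_pow]
    calc _ ≤ (((Φ N).card : ℝ)⁻¹) ^ 2 * ((Φ N).card * ∑ k ∈ Φ N, c k ^ 2) := by gcongr
      _ = _ := by
        have := (hcard N).ne'
        field_simp
  calc _ ≤ ((Φ N).card : ℝ)⁻¹ * ∑ k ∈ Φ N, R * c k := by
        rw [norm_smul, norm_inv, Real.norm_of_nonneg (hcard N).le]
        gcongr
        refine norm_sum_le_of_le _ fun k _ => ?_
        rw [norm_mul]
        exact mul_le_mul_of_nonneg_right (hw k) (norm_nonneg _)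
    _ = R * (((Φ N).card : ℝ)⁻¹ * ∑ k ∈ Φ N, c k) := by rw [← Finset.mul_sum]; ring
    _ ≤ _ := by gcongr

end KoopmanPart

theorem condexp_orth {X Z : Type*} [mX : MeasurableSpace X] (μ : Measure X) [IsProbabilityMeasure μ]
    [MeasurableSpace Z] (π : X → Z) (hπ : Measurable π) (K : Set X) (hK : MeasurableSet K) :
    ∃ G : Z → ℝ, Measurable G ∧ (∀ z, 0 ≤ G z) ∧ (∀ z, G z ≤ 1) ∧
      ∫ x, G (π x) ∂μ = μ.real K ∧
      ∀ h : Z → ℂ, Measurable h → (∃ C : ℝ, ∀ z, ‖h z‖ ≤ C) →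
        ∫ x, ((K.indicator (fun _ => (1 : ℝ)) x - G (π x) : ℝ) : ℂ) * h (π x) ∂μ = 0 := by
  set f : X → ℝ := K.indicator (fun _ => (1 : ℝ)) with hf
  have hfm : Measurable f := measurable_const.indicator hK
  have hf0 : ∀ x, 0 ≤ f x := fun x => Set.indicator_nonneg (fun _ _ => zero_le_one) x
  have hf1 : ∀ x, f x ≤ 1 := fun x => Set.indicator_le_self' (fun _ _ => zero_le_one) x
  have hfi : Integrable f μ := (integrable_const (1 : ℝ)).indicator hK
  obtain ⟨mm, hmm⟩ : ∃ mm : MeasurableSpace X, mm = MeasurableSpace.comap π inferInstance := ⟨_, rfl⟩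
  have hle : mm ≤ mX := hmm ▸ hπ.comap_le
  obtain ⟨G0, hG0m, hG0⟩ : ∃ G0 : Z → ℝ, Measurable G0 ∧ μ[f | mm] = G0 ∘ π := by
    subst hmm
    exact (stronglyMeasurable_condExp (μ := μ) (f := f)).measurable.exists_eq_measurable_comp
  set G : Z → ℝ := fun z => max 0 (min 1 (G0 z)) with hG
  have hGm : Measurable G := measurable_const.max (measurable_const.min hG0m)
  have hG0' : ∀ z, 0 ≤ G z := fun z => le_max_left _ _
  have hG1' : ∀ z, G z ≤ 1 := fun z => max_le zero_le_one (min_le_left _ _)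
  have hGe : (fun x => G (π x)) =ᵐ[μ] μ[f | mm] := by
    have h1 : 0 ≤ᵐ[μ] μ[f | mm] := condExp_nonneg (ae_of_all _ hf0)
    have h2 : μ[f | mm] ≤ᵐ[μ] fun _ => (1 : ℝ) := by
      have := condExp_mono (m := mm) hfi (integrable_const (1 : ℝ)) (ae_of_all μ hf1)
      rwa [condExp_const hle] at this
    filter_upwards [h1, h2] with x h1 h2
    have : μ[f | mm] x = G0 (π x) := congrFun hG0 x
    rw [this] at h1 h2 ⊢
    have h1 : 0 ≤ G0 (π x) := h1
    simp only [hG]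
    rw [min_eq_right h2, max_eq_right h1]
  have hGi : Integrable (fun x => G (π x)) μ := by
    rw [integrable_congr hGe]; exact integrable_condExp
  -- real statement
  have key : ∀ h : Z → ℝ, Measurable h → (∃ C : ℝ, ∀ z, ‖h z‖ ≤ C) →
      ∫ x, (f x - G (π x)) * h (π x) ∂μ = 0 := by
    rintro h hh ⟨C, hC⟩
    have hhs : StronglyMeasurable[mm] (fun x => h (π x)) :=
      by
      subst hmm
      exact (hh.comp (comap_measurable π)).stronglyMeasurable
    have hhs' : AEStronglyMeasurable[mX] (fun x => h (π x)) μ := (hh.comp hπ).aestronglyMeasurable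
    have i1 : Integrable (fun x => h (π x) * f x) μ := hfi.bdd_mul hhs' (ae_of_all _ fun x => hC _)
    have i2 : Integrable (fun x => h (π x) * G (π x)) μ :=
      hGi.bdd_mul hhs' (ae_of_all _ fun x => hC _)
    have e := condExp_mul_of_stronglyMeasurable_left hhs i1 hfi
    have e2 : ∫ x, h (π x) * f x ∂μ = ∫ x, h (π x) * G (π x) ∂μ := by
      rw [show (fun x => h (π x) * f x) = (fun x => h (π x)) * f from rfl, ← integral_condExp hle]
      apply integral_congr_ae
      filter_upwards [e, hGe] with x e1 e2
      rw [e1, Pi.mul_apply, e2]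
    have : (fun x => (f x - G (π x)) * h (π x)) = fun x => h (π x) * f x - h (π x) * G (π x) := by
      ext x; ring
    rw [this, integral_sub i1 i2, e2, sub_self]
  refine ⟨G, hGm, hG0', hG1', ?_, ?_⟩
  · rw [integral_congr_ae hGe, integral_condExp hle, hf, integral_indicator_const _ hK]; simp
  · rintro h hh ⟨C, hC⟩
    clear hGe hG0 hle hmm mm
    have hi : Integrable (fun x => ((f x - G (π x) : ℝ) : ℂ) * h (π x)) μ := by
      have := (hfi.sub hGi).ofReal (𝕜 := ℂ)
      exact this.mul_bdd (hh.comp hπ).aestronglyMeasurable (ae_of_all _ fun x => hC _)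
    apply Complex.ext
    · have := integral_re hi
      simp only [RCLike.re_eq_complex_re, Complex.re_ofReal_mul] at this
      rw [← this]
      exact key (fun z => (h z).re) (Complex.measurable_re.comp hh)
        ⟨C, fun z => (Complex.abs_re_le_norm _).trans (hC z)⟩
    · have := integral_im hi
      simp only [RCLike.im_eq_complex_im, Complex.im_ofReal_mul] at this
      rw [← this]
      exact key (fun z => (h z).im) (Complex.measurable_im.comp hh)
        ⟨C, fun z => (Complex.abs_im_le_norm _).trans (hC z)⟩

theorem find_of_kronecker {Z : Type*} [CommGroup Z] [TopologicalSpace Z] [IsTopologicalGroup Z]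
    [CompactSpace Z] [T2Space Z] [SecondCountableTopology Z] [MeasurableSpace Z] [BorelSpace Z]
    {X : Type*} [MetricSpace X] [CompactSpace X] [MeasurableSpace X] [BorelSpace X]
    (T : X ≃ₜ X) (μ : Measure X) [IsProbabilityMeasure μ] (hT : MeasurePreserving T μ μ)
    (ℓ m : ℕ) (hℓ : 0 < ℓ) (hm : 0 < m) (a : X) (Φ : ℕ → Finset ℕ) (hΦ : IsFolnerSeq Φ)
    (ha : GenericAlong T μ a Φ)
    (α : Z) (hα : Dense (Subgroup.zpowers α : Set Z))
    (π : X → Z) (hπ : Measurable π) (hπT : ∀ᵐ x ∂μ, π (T x) = α * π x)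
    (hfac : ∀ e : X → ℂ, MemLp e 2 μ → ∀ l : ℂ, (∀ᵐ x ∂μ, e (T x) = l * e x) →
      ∃ h : Z → ℂ, Measurable h ∧ (∃ C : ℝ, ∀ z, ‖h z‖ ≤ C) ∧ e =ᵐ[μ] fun x => h (π x))
    (K : Set X) (hK : MeasurableSet K) (hKl : (ℓ + m : ℝ) * (1 - μ.real K) < 1) :
    ∃ x₁ : X, ∀ U, IsOpen U → x₁ ∈ U →
      ∃ᶠ n in atTop, T^[ℓ * n] a ∈ U ∧ T^[m * n] x₁ ∈ K := by
  obtain ⟨G, hG, hG0, hG1, hGK, horth⟩ := condexp_orth μ π hπ K hK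
  have hp : ((hyperfilter ℕ : Ultrafilter ℕ) : Filter ℕ) ≤ atTop := by
    rw [← Nat.cofinite_eq_atTop]; exact hyperfilter_le_cofinite
  let η : Measure Z := Measure.haarMeasure ⊤
  haveI : IsProbabilityMeasure η := ⟨by
    have := Measure.haarMeasure_self (K₀ := (⊤ : TopologicalSpace.PositiveCompacts Z))
    simpa using this⟩
  refine core_find T μ hT ℓ m hℓ a Φ hΦ ha (hyperfilter ℕ) hp η α hα π hπ hπT K hK G hG hG0 hG1
    hGK hKl ?_
  intro D hD w R hw
  refine hwm_of_orth T μ hT ℓ m hℓ hm Φ hΦ (hyperfilter ℕ) hp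
    (fun x => K.indicator (fun _ => (1 : ℝ)) x - G (π x))
    ((measurable_const.indicator hK).sub (hG.comp hπ)) ?_ ?_ D hD w R hw
  · intro x
    have h1 := hG0 (π x)
    have h2 := hG1 (π x)
    rw [Real.norm_eq_abs, abs_le]
    by_cases hx : x ∈ K <;> simp [hx] <;> constructor <;> linarith
  · intro e he l hel
    obtain ⟨h, hh, ⟨C, hC⟩, hee⟩ := hfac e he l hel
    rw [← horth (fun z => (starRingEnd ℂ) (h z)) (Complex.continuous_conj.measurable.comp hh)
      ⟨C, fun z => by simpa using hC z⟩]
    apply integral_congr_ae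
    filter_upwards [hee] with x hx
    rw [hx]

theorem circ_cont : Continuous (fun z : Circle => (z : ℂ)) := continuous_subtype_val

theorem sq_one_aux (x : ℝ) (hx : 0 ≤ x) (h : x ^ 2 = 1) : x = 1 := by nlinarith

theorem eig_circle {X : Type*} [MeasurableSpace X] (T : X → X) (μ : Measure X)
    [IsProbabilityMeasure μ] (hT : Ergodic T μ) (e : X → ℂ) (he : MemLp e 2 μ) (l : ℂ)
    (hel : ∀ᵐ x ∂μ, e (T x) = l * e x) (hne : ¬ e =ᵐ[μ] 0) :
    ∃ (s : Circle) (φ : X → Circle) (c : ℂ), StronglyMeasurable φ ∧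
      (∀ᵐ x ∂μ, φ (T x) = s * φ x) ∧ e =ᵐ[μ] fun x => c * φ x := by
  have hmp := hT.toMeasurePreserving
  have hI : Integrable (fun x => ‖e x‖ ^ 2) μ := he.integrable_norm_pow (by norm_num)
  have h1 : ∫ x, ‖e (T x)‖ ^ 2 ∂μ = ∫ x, ‖e x‖ ^ 2 ∂μ := by
    have := integral_map (μ := μ) hmp.aemeasurable (f := fun x => ‖e x‖ ^ 2)
      (by rw [hmp.map_eq]; exact hI.aestronglyMeasurable)
    rw [hmp.map_eq] at this
    exact this.symm
  have h2 : ∫ x, ‖e (T x)‖ ^ 2 ∂μ = ‖l‖ ^ 2 * ∫ x, ‖e x‖ ^ 2 ∂μ := by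
    rw [← integral_const_mul]
    apply integral_congr_ae
    filter_upwards [hel] with x hx
    rw [hx, norm_mul, mul_pow]
  have h3 : ∫ x, ‖e x‖ ^ 2 ∂μ ≠ 0 := by
    intro h
    rw [integral_eq_zero_iff_of_nonneg (fun x => by positivity) hI] at h
    apply hne
    filter_upwards [h] with x hx
    simpa using hx
  have hl : ‖l‖ = 1 := by
    rw [h1] at h2
    have : ‖l‖ ^ 2 = 1 := mul_right_cancel₀ h3 (by linarith)
    exact sq_one_aux _ (norm_nonneg l) this
  obtain ⟨c, hc⟩ := hT.ae_eq_const_of_ae_eq_comp_ae (g := fun x => ‖e x‖) he.1.norm (by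
    filter_upwards [hel] with x hx
    simp [hx, hl])
  have hc0 : c ≠ 0 := by
    rintro rfl
    apply hne
    filter_upwards [hc] with x hx
    simpa using hx
  set e' := he.1.mk e with he'
  have hee : e =ᵐ[μ] e' := he.1.ae_eq_mk
  set φ : X → Circle := fun x => Circle.exp (Complex.arg (e' x)) with hφ
  have hφm : StronglyMeasurable φ := by
    have := (Complex.measurable_arg.comp he.1.stronglyMeasurable_mk.measurable).stronglyMeasurable
    exact Circle.exp.continuous.comp_stronglyMeasurable this
  have hecφ : e =ᵐ[μ] fun x => (c : ℂ) * φ x := by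
    filter_upwards [hee, hc] with x h1 h2
    have h2 : ‖e x‖ = c := h2
    have := Complex.norm_mul_exp_arg_mul_I (e x)
    rw [h2] at this
    simp only [hφ, Circle.coe_exp, ← h1]
    exact this.symm
  refine ⟨Circle.exp (Complex.arg l), φ, c, hφm, ?_, hecφ⟩
  have hecT := hmp.quasiMeasurePreserving.ae hecφ
  filter_upwards [hecφ, hecT, hel] with x h1 h2 h3
  apply Circle.ext
  have hl' := Complex.norm_mul_exp_arg_mul_I l
  rw [hl] at hl'
  simp only [Complex.ofReal_one, one_mul] at hl'
  rw [Circle.coe_mul, Circle.coe_exp l.arg, hl']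
  have hc' : (c : ℂ) ≠ 0 := by exact_mod_cast hc0
  apply mul_left_cancel₀ hc'
  rw [← h2, h3, h1]; ring

theorem circle_unique {X : Type*} [MeasurableSpace X] (T : X → X) (μ : Measure X)
    (hT : Ergodic T μ) (s : Circle) (φ ψ : X → Circle) (hφ : StronglyMeasurable φ)
    (hψ : StronglyMeasurable ψ) (h1 : ∀ᵐ x ∂μ, φ (T x) = s * φ x)
    (h2 : ∀ᵐ x ∂μ, ψ (T x) = s * ψ x) : ∃ d : Circle, ∀ᵐ x ∂μ, φ x = d * ψ x := by
  have hm : StronglyMeasurable (fun x => φ x / ψ x) := by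
    exact (continuous_fst.div' continuous_snd).comp_stronglyMeasurable (hφ.prodMk hψ)
  obtain ⟨d, hd⟩ := hT.ae_eq_const_of_ae_eq_comp_ae hm.aestronglyMeasurable (by
    filter_upwards [h1, h2] with x h1 h2
    simp [h1, h2])
  refine ⟨d, ?_⟩
  filter_upwards [hd] with x hx
  have hx : φ x / ψ x = d := hx
  rw [← hx, div_mul_cancel]

theorem eig_countable {X : Type*} [MetricSpace X] [CompactSpace X] [MeasurableSpace X]
    [BorelSpace X] (T : X → X) (μ : Measure X)
    [IsProbabilityMeasure μ] (hT : MeasurePreserving T μ μ) :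
    {s : Circle | ∃ φ : X → Circle, StronglyMeasurable φ ∧
      ∀ᵐ x ∂μ, φ (T x) = s * φ x}.Countable := by
  set S := {s : Circle | ∃ φ : X → Circle, StronglyMeasurable φ ∧
      ∀ᵐ x ∂μ, φ (T x) = s * φ x} with hS
  choose! φ hφm hφ using fun (s : Circle) (hs : s ∈ S) => hs
  have hmem : ∀ s : S, MemLp (fun x => (φ s x : ℂ)) 2 μ := fun s =>
    MemLp.of_bound ((circ_cont.comp_stronglyMeasurable
      (hφm s s.2)).aestronglyMeasurable) 1 (ae_of_all _ fun x => (Circle.norm_coe _).le)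
  let F : S → Lp ℂ 2 μ := fun s => (hmem s).toLp
  have horth : ∀ s t : S, s ≠ t → inner ℂ (F s) (F t) = 0 := by
    intro s t hst
    rw [L2.inner_def]
    have e1 : ∫ x, inner ℂ (F s x) (F t x) ∂μ = ∫ x, (starRingEnd ℂ) (φ s x : ℂ) * φ t x ∂μ := by
      apply integral_congr_ae
      filter_upwards [(hmem s).coeFn_toLp, (hmem t).coeFn_toLp] with x h1 h2
      simp only [F, h1, h2, RCLike.inner_apply]
      ring
    rw [e1]
    set g : X → ℂ := fun x => (starRingEnd ℂ) (φ s x : ℂ) * φ t x with hg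
    have hgm : AEStronglyMeasurable g μ := by
      have a := circ_cont.comp_stronglyMeasurable (hφm s s.2)
      have b := circ_cont.comp_stronglyMeasurable (hφm t t.2)
      exact ((Complex.continuous_conj.comp_stronglyMeasurable a).mul b).aestronglyMeasurable
    have h1 : ∫ x, g (T x) ∂μ = ∫ x, g x ∂μ := by
      have := integral_map (μ := μ) hT.aemeasurable (f := g) (by rw [hT.map_eq]; exact hgm)
      rw [hT.map_eq] at this
      exact this.symm
    have h2 : ∫ x, g (T x) ∂μ = ((s : Circle)⁻¹ * t : Circle) * ∫ x, g x ∂μ := by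
      rw [← integral_const_mul]
      apply integral_congr_ae
      filter_upwards [hφ s s.2, hφ t t.2] with x h1 h2
      simp only [hg, h1, h2, Circle.coe_mul, map_mul, Circle.coe_inv_eq_conj]
      ring
    by_contra hne
    rw [h1] at h2
    have : (((s : Circle)⁻¹ * t : Circle) : ℂ) = 1 := by
      apply mul_right_cancel₀ hne
      rw [← h2, one_mul]
    have h4 : ((s : Circle)⁻¹ * t : Circle) = 1 := Circle.ext (by simpa using this)
    exact hst (Subtype.ext (inv_mul_eq_one.1 h4))
  have hnorm : ∀ s : S, ‖F s‖ = 1 := by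
    intro s
    have e : ‖F s‖ ^ 2 = 1 := by
      have h := inner_self_eq_norm_sq_to_K (𝕜 := ℂ) (F s)
      rw [L2.inner_def] at h
      have e1 : ∫ x, inner ℂ (F s x) (F s x) ∂μ = 1 := by
        have : ∫ x, inner ℂ (F s x) (F s x) ∂μ = ∫ x, (1 : ℂ) ∂μ := by
          apply integral_congr_ae
          filter_upwards [(hmem s).coeFn_toLp] with x h1
          simp only [F, h1]
          rw [inner_self_eq_norm_sq_to_K, Circle.norm_coe]; simp
        rw [this]; simp
      rw [e1] at h
      have h' : ((‖F s‖ ^ 2 : ℝ) : ℂ) = ((1 : ℝ) : ℂ) := by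
        rw [Complex.ofReal_pow, Complex.ofReal_one]; exact h.symm
      exact Complex.ofReal_injective h'
    exact sq_one_aux _ (norm_nonneg _) e
  have hdist : ∀ s t : S, s ≠ t → 1 ≤ dist (F s) (F t) := by
    intro s t hst
    rw [dist_eq_norm]
    have := norm_sub_sq (𝕜 := ℂ) (F s) (F t)
    rw [horth s t hst, hnorm, hnorm] at this
    simp at this
    have h0 := norm_nonneg (F s - F t)
    nlinarith
  haveI : Fact ((2 : ENNReal) ≠ ⊤) := ⟨by simp⟩
  have hd : (Set.univ : Set S).PairwiseDisjoint (fun s => Metric.ball (F s) (1/2)) := by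
    intro s _ t _ hst
    apply Metric.ball_disjoint_ball
    have := hdist s t hst
    linarith
  have := hd.countable_of_isOpen (fun _ _ => Metric.isOpen_ball)
    (fun s _ => ⟨F s, Metric.mem_ball_self (by norm_num)⟩)
  exact Set.countable_coe_iff.1 (Set.countable_univ_iff.1 this)

theorem exists_translate {X W : Type*} [MeasurableSpace X] (T : X → X) (μ : Measure X)
    [IsProbabilityMeasure μ] (hT : Ergodic T μ) [CommGroup W] [TopologicalSpace W]
    [IsTopologicalGroup W] [CompactSpace W] [T2Space W] [SecondCountableTopology W]
    (Z : Subgroup W) (hZ : IsClosed (Z : Set W)) (α : W) (hα : α ∈ Z)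
    (φ : X → W) (hφm : StronglyMeasurable φ) (hφ : ∀ᵐ x ∂μ, φ (T x) = α * φ x) :
    ∃ w : W, ∀ᵐ x ∂μ, w⁻¹ * φ x ∈ Z := by
  have : IsClosed (Z : Set W) := hZ
  have hm : StronglyMeasurable (fun x => (φ x : W ⧸ Z)) :=
    (QuotientGroup.continuous_mk (N := Z)).comp_stronglyMeasurable hφm
  have : T3Space (W ⧸ Z) := inferInstance
  have : SecondCountableTopology (W ⧸ Z) := inferInstance
  obtain ⟨c, hc⟩ := hT.ae_eq_const_of_ae_eq_comp_ae hm.aestronglyMeasurable (by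
    filter_upwards [hφ] with x hx
    show ((φ (T x) : W) : W ⧸ Z) = (φ x : W ⧸ Z)
    rw [hx, QuotientGroup.eq]
    have : (α * φ x)⁻¹ * φ x = α⁻¹ := by
      rw [mul_inv, mul_assoc, inv_mul_cancel, mul_one]
    rw [this]
    exact Z.inv_mem hα)
  obtain ⟨w, rfl⟩ := QuotientGroup.mk_surjective c
  refine ⟨w, ?_⟩
  filter_upwards [hc] with x hx
  exact QuotientGroup.eq.1 (Eq.symm hx)

theorem kronecker_find
    {X : Type*} [MetricSpace X] [CompactSpace X] [MeasurableSpace X] [BorelSpace X]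
    (T : X ≃ₜ X) (μ : Measure X) [IsProbabilityMeasure μ] (hT : Ergodic T μ)
    (ℓ m : ℕ) (hℓ : 0 < ℓ) (hm : 0 < m) (a : X) (Φ : ℕ → Finset ℕ) (hΦ : IsFolnerSeq Φ)
    (ha : GenericAlong T μ a Φ)
    (K : Set X) (hK : MeasurableSet K) (hKl : (ℓ + m : ℝ) * (1 - μ.real K) < 1) :
    ∃ x₁ : X, ∀ U, IsOpen U → x₁ ∈ U →
      ∃ᶠ n in atTop, T^[ℓ * n] a ∈ U ∧ T^[m * n] x₁ ∈ K := by
  classical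
  have hcount := eig_countable T μ hT.toMeasurePreserving
  set S := {s : Circle | ∃ φ : X → Circle, StronglyMeasurable φ ∧
      ∀ᵐ x ∂μ, φ (T x) = s * φ x} with hS
  have : Countable S := hcount.to_subtype
  choose φ hφm hφ using fun s : S => s.2
  letI : MeasurableSpace Circle := borel Circle
  have : BorelSpace Circle := ⟨rfl⟩
  let F : X → S → Circle := fun x s => φ s x
  let α₀ : S → Circle := fun s => s
  have hFm : Measurable F := measurable_pi_lambda _ fun s => (hφm s).measurable
  have hF : ∀ᵐ x ∂μ, F (T x) = α₀ * F x := by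
    filter_upwards [ae_all_iff.2 hφ] with x hx
    ext1 s
    exact hx s
  let Z : Subgroup (S → Circle) := (Subgroup.zpowers α₀).topologicalClosure
  have hZc : IsClosed (Z : Set (S → Circle)) := Subgroup.isClosed_topologicalClosure _
  have hαZ : α₀ ∈ Z := Subgroup.le_topologicalClosure _ (Subgroup.mem_zpowers α₀)
  obtain ⟨w, hw⟩ := exists_translate T μ hT Z hZc α₀ hαZ F hFm.stronglyMeasurable hF
  have : CompactSpace Z := isCompact_iff_compactSpace.1 hZc.isCompact
  have : SecondCountableTopology Z :=
    TopologicalSpace.Subtype.secondCountableTopology (Z : Set (S → Circle))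
  let α : Z := ⟨α₀, hαZ⟩
  have hα : Dense (Subgroup.zpowers α : Set Z) := by
    intro z
    rw [Topology.IsInducing.subtypeVal.closure_eq_preimage_closure_image]
    have h1 : (Subtype.val '' (Subgroup.zpowers α : Set Z)) =
        (Subgroup.zpowers α₀ : Set (S → Circle)) := by
      ext y
      constructor
      · rintro ⟨z, ⟨k, rfl⟩, rfl⟩
        exact ⟨k, rfl⟩
      · rintro ⟨k, rfl⟩
        exact ⟨α ^ k, ⟨k, rfl⟩, rfl⟩
    have h2 : (z : S → Circle) ∈ closure (Subgroup.zpowers α₀ : Set (S → Circle)) := z.2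
    rw [← h1] at h2
    exact h2
  let g : X → S → Circle := fun x => if w⁻¹ * F x ∈ Z then w⁻¹ * F x else 1
  have hgZ : ∀ x, g x ∈ Z := by
    intro x
    by_cases h : w⁻¹ * F x ∈ Z
    · simp only [g, if_pos h]; exact h
    · simp only [g, if_neg h]; exact Z.one_mem
  have hwF : Measurable (fun x => w⁻¹ * F x) := (continuous_const_mul w⁻¹).measurable.comp hFm
  have hgm : Measurable g :=
    Measurable.ite (hwF hZc.measurableSet) hwF measurable_const
  have hgF : ∀ᵐ x ∂μ, g x = w⁻¹ * F x := by
    filter_upwards [hw] with x hx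
    simp only [g, if_pos hx]
  let π : X → Z := fun x => ⟨g x, hgZ x⟩
  have hπ : Measurable π := hgm.subtype_mk
  have hπT : ∀ᵐ x ∂μ, π (T x) = α * π x := by
    have hq := hT.toMeasurePreserving.quasiMeasurePreserving.ae hgF
    filter_upwards [hgF, hq, hF] with x h1 h2 h3
    apply Subtype.ext
    show g (T x) = α₀ * g x
    rw [h1, h2, h3, mul_left_comm]
  refine find_of_kronecker T μ hT.toMeasurePreserving ℓ m hℓ hm a Φ hΦ ha α hα π hπ hπT ?_ K hK hKl
  intro e he l hel
  by_cases h0 : e =ᵐ[μ] 0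
  · exact ⟨fun _ => 0, measurable_const, ⟨0, fun z => by simp⟩, h0⟩
  obtain ⟨s, ψ, c, hψm, hψ, hec⟩ := eig_circle T μ hT e he l hel h0
  have hs : s ∈ S := ⟨ψ, hψm, hψ⟩
  obtain ⟨d, hd⟩ := circle_unique T μ hT s ψ (φ ⟨s, hs⟩) hψm (hφm _) hψ (hφ ⟨s, hs⟩)
  refine ⟨fun z => c * ((d * (w ⟨s, hs⟩ * (z : S → Circle) ⟨s, hs⟩) : Circle) : ℂ), ?_, ⟨‖c‖, ?_⟩, ?_⟩
  · have hc1 : Continuous fun z : Z => d * (w ⟨s, hs⟩ * (z : S → Circle) ⟨s, hs⟩) :=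
      continuous_const.mul (continuous_const.mul ((continuous_apply _).comp continuous_subtype_val))
    exact (continuous_const.mul (circ_cont.comp hc1)).measurable
  · intro z
    rw [norm_mul, Circle.norm_coe, mul_one]
  · filter_upwards [hec, hd, hgF] with x h1 h2 h3
    have h4 : w ⟨s, hs⟩ * g x ⟨s, hs⟩ = φ ⟨s, hs⟩ x := by
      rw [h3]
      simp [F]
    show e x = c * ((d * (w ⟨s, hs⟩ * g x ⟨s, hs⟩) : Circle) : ℂ)
    rw [h4, ← h2, h1]

/-- **Dynamical form of the main theorem.** For an ergodic system `(X, μ, T)` on a compact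
metric space, a point `a` generic for `μ` along a Følner sequence `Φ`, and an open set
`E` with `μ(E) > 0`, there exist `x₁, x₂ ∈ X` and `t ∈ ℕ` such that `(a, x₁, x₂)` is an
`(ℓ,m)`-Erdős progression and `T^t x₂ ∈ E`. -/
theorem dynamical_mB_add_lB {X : Type*} [MetricSpace X] [CompactSpace X]
    [MeasurableSpace X] [BorelSpace X]
    (T : X ≃ₜ X) (μ : Measure X) [IsProbabilityMeasure μ]
    (hT : Ergodic (⇑T) μ)
    (ℓ m : ℕ) (hℓ : 0 < ℓ) (hm : 0 < m)
    (a : X) (Φ : ℕ → Finset ℕ) (hΦ : IsFolnerSeq Φ)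
    (ha : GenericAlong (⇑T) μ a Φ)
    (E : Set X) (hE : IsOpen E) (hEpos : 0 < μ E) :
    ∃ x₁ x₂ : X, ∃ t : ℕ, 0 < t ∧
      ErdosProg (⇑T) ℓ m a x₁ x₂ ∧ (⇑T)^[t] x₂ ∈ E := by
  obtain ⟨K, hKc, hKl, hKE⟩ := exists_big_compact T μ hT E hE hEpos (ℓ + m) (by omega)
  obtain ⟨x₁, hx₁⟩ := kronecker_find T μ hT ℓ m hℓ hm a Φ hΦ ha K hKc.isClosed.measurableSet
    (by push_cast at hKl; exact hKl)
  obtain ⟨x₂, hx₂, hprog⟩ := extract_prog T ℓ m a x₁ K hKc hx₁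
  obtain ⟨t, ht, htE⟩ := hKE x₂ hx₂
  exact ⟨x₁, x₂, t, ht, hprog, htE⟩
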